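/- arXiv:1804.02536 — 7 statements merged into one kernel-verified Lean document; each statement's English description precedes it below -/
import Mathlib

section
/- Let t₀ ∈ ℝ, a > 0, J = [t₀, t₀ + a], and let 0 < α < 1. Let z : ℝ → ℝ be continuously differentiable and strictly increasing on J with z'(t) > 0 for all t ∈ J, and let y : J → ℝ be continuous. Then for every t ∈ J, the composition of generalized fractional integrals satisfies (I^α_{t₀;z} (I^{1−α}_{t₀;z} y))(t) = ∫_{t₀}^{t} z'(s) y(s) ds; that is, applying the generalized fractional integral of order α to the generalized fractional integral of order 1−α of y gives the first-order integral of y with respect to z. -/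
open MeasureTheory Set

/-- The real beta integral with parameters `1 - α` and `α`, transported to `[c, d]`. -/
theorem integral_rpow_sub_mul_rpow_sub {α c d : ℝ} (hα₀ : 0 < α) (hα₁ : α < 1) (hcd : c < d) :
    ∫ u in c..d, (d - u) ^ (α - 1) * (u - c) ^ (-α) = Real.Gamma α * Real.Gamma (1 - α) := by
  have hdc : 0 < d - c := sub_pos.2 hcd
  have hshift := intervalIntegral.integral_comp_sub_right (a := c) (b := d)
    (fun x : ℝ => (d - c - x) ^ (α - 1) * x ^ (-α)) c
  simp only [sub_self, sub_sub_sub_cancel_right] at hshift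
  rw [hshift]
  have hbeta := Complex.betaIntegral_scaled ((1 - α : ℝ) : ℂ) (α : ℂ) hdc
  have hGamma := Complex.Gamma_mul_Gamma_eq_betaIntegral (s := ((1 - α : ℝ) : ℂ)) (t := (α : ℂ))
    (by simpa using hα₁) (by simpa using hα₀)
  have hsum : ((1 - α : ℝ) : ℂ) + (α : ℂ) = 1 := by push_cast; ring
  rw [hsum, Complex.Gamma_one, one_mul, Complex.Gamma_ofReal, Complex.Gamma_ofReal] at hGamma
  rw [hsum, sub_self, Complex.cpow_zero, one_mul, ← hGamma] at hbeta
  rw [← Complex.ofReal_inj, ← intervalIntegral.integral_ofReal, mul_comm (Real.Gamma α),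
    Complex.ofReal_mul, ← hbeta]
  refine intervalIntegral.integral_congr fun x hx => ?_
  rw [uIcc_of_le hdc.le] at hx
  have h1 := Complex.ofReal_cpow hx.1 (-α)
  have h2 := Complex.ofReal_cpow (sub_nonneg.2 hx.2) (α - 1)
  simp only [Complex.ofReal_mul]
  rw [h1, h2, mul_comm]
  push_cast
  congr 2
  ring

/-- The beta integral after the substitution `u = z s`. -/
theorem integral_rpow_sub_mul_rpow_sub_mul_deriv {α r t : ℝ} (hα₀ : 0 < α) (hα₁ : α < 1)
    (hrt : r < t) {z z' : ℝ → ℝ} (hz : ∀ s ∈ Icc r t, HasDerivAt z (z' s) s)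
    (hz' : ∀ s ∈ Icc r t, 0 < z' s) (hzrt : z r < z t) :
    ∫ s in r..t, (z t - z s) ^ (α - 1) * (z s - z r) ^ (-α) * z' s =
      Real.Gamma α * Real.Gamma (1 - α) := by
  rw [← integral_rpow_sub_mul_rpow_sub hα₀ hα₁ hzrt,
    ← intervalIntegral.integral_comp_mul_deriv_of_deriv_nonneg (f := z) (f' := z')]
  · rfl
  · rw [uIcc_of_le hrt.le]
    exact fun s hs => (hz s hs).continuousAt.continuousWithinAt
  · rw [min_eq_left hrt.le, max_eq_right hrt.le]
    exact fun s hs => hz s (Ioo_subset_Icc_self hs)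
  · rw [min_eq_left hrt.le, max_eq_right hrt.le]
    exact fun s hs => (hz' s (Ioo_subset_Icc_self hs)).le

/-- Fubini's theorem on the triangle `t₀ < r < s < t`, for the product of a nonnegative kernel
`K s r` of constant mass `C ≠ 0` in `s` and an integrable weight `w r`. -/
theorem integral_integral_triangle_kernel {t₀ t C : ℝ} (hC : C ≠ 0) {K : ℝ → ℝ → ℝ} {w : ℝ → ℝ}
    (hK : AEStronglyMeasurable (Function.uncurry K)
      ((volume.restrict (Ioo t₀ t)).prod (volume.restrict (Ioo t₀ t))))
    (hK_nonneg : ∀ r ∈ Ioo t₀ t, ∀ s ∈ Ioo r t, 0 ≤ K s r)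
    (hK_mass : ∀ r ∈ Ioo t₀ t, ∫ s in Ioo r t, K s r = C)
    (hw : IntegrableOn w (Ioo t₀ t)) :
    ∫ s in Ioo t₀ t, ∫ r in Ioo t₀ s, K s r * w r = C * ∫ r in Ioo t₀ t, w r := by
  set μ := volume.restrict (Ioo t₀ t) with hμ
  set D : Set (ℝ × ℝ) := {p | p.2 < p.1} with hD
  have hDm : MeasurableSet D := measurableSet_lt measurable_snd measurable_fst
  set F : ℝ → ℝ → ℝ := fun s r => D.indicator (fun p => K p.1 p.2 * w p.2) (s, r) with hF
  have hF_fst (s r : ℝ) : F s r = (Iio s).indicator (fun r => K s r * w r) r := by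
    simp [hF, hD, indicator_apply]
  have hF_snd (s r : ℝ) : F s r = (Ioi r).indicator (fun s => K s r * w r) s := by
    simp [hF, hD, indicator_apply]
  have hres {r : ℝ} (hr : r ∈ Ioo t₀ t) : μ.restrict (Ioi r) = volume.restrict (Ioo r t) := by
    rw [hμ, Measure.restrict_restrict measurableSet_Ioi]
    congr 1
    ext x
    simp only [mem_inter_iff, mem_Ioi, mem_Ioo]
    exact ⟨fun h => ⟨h.1, h.2.2⟩, fun h => ⟨h.1, hr.1.trans h.1, h.2⟩⟩
  have hK_int {r : ℝ} (hr : r ∈ Ioo t₀ t) : IntegrableOn (fun s => K s r) (Ioo r t) := by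
    by_contra h
    exact hC ((hK_mass r hr).symm.trans (integral_undef h))
  have hF_meas : AEStronglyMeasurable (Function.uncurry F) (μ.prod μ) :=
    (hK.mul hw.aestronglyMeasurable.comp_snd).indicator hDm
  have hF_int : Integrable (Function.uncurry F) (μ.prod μ) := by
    rw [integrable_prod_iff' hF_meas]
    constructor
    · filter_upwards [ae_restrict_mem measurableSet_Ioo] with r hr
      simp only [Function.uncurry_apply_pair, hF_snd]
      rw [integrable_indicator_iff measurableSet_Ioi, IntegrableOn, hres hr]
      exact (hK_int hr).mul_const _
    · refine (hw.norm.const_mul C).congr ?_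
      filter_upwards [ae_restrict_mem measurableSet_Ioo] with r hr
      simp only [Function.uncurry_apply_pair, hF_snd, norm_indicator_eq_indicator_norm]
      rw [integral_indicator measurableSet_Ioi, hres hr, ← hK_mass r hr, ← integral_mul_const]
      refine setIntegral_congr_fun measurableSet_Ioo fun s hs => ?_
      simp only [norm_mul]
      rw [Real.norm_of_nonneg (hK_nonneg r hr s hs)]
  calc
    _ = ∫ s, ∫ r, F s r ∂μ ∂μ := by
      refine setIntegral_congr_fun measurableSet_Ioo fun s hs => ?_
      simp only [hF_fst]
      rw [integral_indicator measurableSet_Iio, hμ, Measure.restrict_restrict measurableSet_Iio]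
      congr 2
      ext x
      simp only [mem_inter_iff, mem_Iio, mem_Ioo]
      exact ⟨fun h => ⟨h.2, h.1, h.2.trans hs.2⟩, fun h => ⟨h.2.1, h.1⟩⟩
    _ = ∫ r, ∫ s, F s r ∂μ ∂μ := integral_integral_swap hF_int
    _ = ∫ r, C * w r ∂μ := by
      refine setIntegral_congr_fun measurableSet_Ioo fun r hr => ?_
      simp only [hF_snd]
      rw [integral_indicator measurableSet_Ioi, hres hr, integral_mul_const, hK_mass r hr]
    _ = _ := integral_const_mul _ _


/-- On `𝕋 = ℝ`, the composition of generalized fractional integrals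
of orders `α` and `1 − α` with respect to `z` gives the first-order integral with
respect to `z`: `(I^α_{t₀;z} (I^{1−α}_{t₀;z} y))(t) = ∫_{t₀}^{t} z'(s) y(s) ds`. -/
theorem generalized_fractional_integral_comp
    (t₀ a α : ℝ) (ha : 0 < a) (hα₀ : 0 < α) (hα₁ : α < 1)
    (z z' : ℝ → ℝ)
    (hz_deriv : ∀ t ∈ Set.Icc t₀ (t₀ + a), HasDerivAt z (z' t) t)
    (hz'_cont : ContinuousOn z' (Set.Icc t₀ (t₀ + a)))
    (hz_mono : StrictMonoOn z (Set.Icc t₀ (t₀ + a)))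
    (hz'_pos : ∀ t ∈ Set.Icc t₀ (t₀ + a), 0 < z' t)
    (y : ℝ → ℝ) (hy : ContinuousOn y (Set.Icc t₀ (t₀ + a))) :
    ∀ t ∈ Set.Icc t₀ (t₀ + a),
      (1 / Real.Gamma α) * ∫ s in t₀..t, (z t - z s) ^ (α - 1) * z' s *
          ((1 / Real.Gamma (1 - α)) * ∫ r in t₀..s, (z s - z r) ^ (-α) * z' r * y r)
        = ∫ s in t₀..t, z' s * y s := by
  intro t ht
  have hsub : Icc t₀ t ⊆ Icc t₀ (t₀ + a) := Icc_subset_Icc_right ht.2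
  have hz_cont : ContinuousOn z (Icc t₀ (t₀ + a)) := fun s hs =>
    (hz_deriv s hs).continuousAt.continuousWithinAt
  have hIoo : Ioo t₀ t ⊆ Icc t₀ (t₀ + a) := Ioo_subset_Icc_self.trans hsub
  have hΓ : Real.Gamma α * Real.Gamma (1 - α) ≠ 0 :=
    (mul_pos (Real.Gamma_pos_of_pos hα₀) (Real.Gamma_pos_of_pos (sub_pos.2 hα₁))).ne'
  have hz_meas : AEMeasurable z (volume.restrict (Ioo t₀ t)) :=
    (hz_cont.mono hIoo).aemeasurable measurableSet_Ioo
  have hz'_meas : AEMeasurable z' (volume.restrict (Ioo t₀ t)) :=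
    (hz'_cont.mono hIoo).aemeasurable measurableSet_Ioo
  have hfubini := integral_integral_triangle_kernel (t₀ := t₀) (t := t) hΓ
    (K := fun s r => (z t - z s) ^ (α - 1) * (z s - z r) ^ (-α) * z' s)
    (w := fun r => z' r * y r)
    ((((hz_meas.comp_fst.const_sub _).pow_const _).mul
      ((hz_meas.comp_fst.sub hz_meas.comp_snd).pow_const _)).mul
        hz'_meas.comp_fst).aestronglyMeasurable
    (fun r hr s hs => by
      have hs' : s ∈ Icc t₀ (t₀ + a) := hIoo ⟨hr.1.trans hs.1, hs.2⟩
      exact mul_nonneg (mul_nonneg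
        (Real.rpow_nonneg (sub_nonneg.2 (hz_mono hs' ht hs.2).le) _)
        (Real.rpow_nonneg (sub_nonneg.2 (hz_mono (hIoo hr) hs' hs.1).le) _)) (hz'_pos s hs').le)
    (fun r hr => by
      have hsub' : Icc r t ⊆ Icc t₀ (t₀ + a) := Icc_subset_Icc hr.1.le ht.2
      rw [← integral_Ioc_eq_integral_Ioo, ← intervalIntegral.integral_of_le hr.2.le]
      exact integral_rpow_sub_mul_rpow_sub_mul_deriv hα₀ hα₁ hr.2
        (fun s hs => hz_deriv s (hsub' hs)) (fun s hs => hz'_pos s (hsub' hs))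
        (hz_mono (hIoo hr) ht hr.2))
    ((((hz'_cont.mul hy).mono hsub).integrableOn_Icc).mono_set Ioo_subset_Icc_self)
  rw [intervalIntegral.integral_of_le ht.1, intervalIntegral.integral_of_le ht.1,
    integral_Ioc_eq_integral_Ioo, integral_Ioc_eq_integral_Ioo]
  have hinner : ∫ s in Ioo t₀ t, (z t - z s) ^ (α - 1) * z' s *
      ((1 / Real.Gamma (1 - α)) * ∫ r in t₀..s, (z s - z r) ^ (-α) * z' r * y r) =
      (1 / Real.Gamma (1 - α)) * ∫ s in Ioo t₀ t, ∫ r in Ioo t₀ s,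
        (z t - z s) ^ (α - 1) * (z s - z r) ^ (-α) * z' s * (z' r * y r) := by
    rw [← integral_const_mul]
    refine setIntegral_congr_fun measurableSet_Ioo fun s hs => ?_
    rw [intervalIntegral.integral_of_le hs.1.le, integral_Ioc_eq_integral_Ioo, mul_left_comm,
      ← integral_const_mul]
    congr 2
    funext r
    ring
  rw [hinner, hfubini]
  have h1 := left_ne_zero_of_mul hΓ
  have h2 := right_ne_zero_of_mul hΓ
  field_simp
end

section
/- Let t₀ ∈ ℝ, a > 0, J = [t₀, t₀ + a], and let 0 < α < 1. Let z : ℝ → ℝ be continuously differentiable and strictly increasing on J with z'(t) > 0 for all t ∈ J. Let f : J × ℝ → ℝ be continuous and suppose there exists L > 0 such that |f(t,u) − f(t,v)| ≤ L·|u − v| for all t ∈ J and u, v ∈ ℝ. If sup_{t ∈ J} L · z'(t) · M_α(t) · (t − t₀) / Γ(α) < 1, then there exists a unique continuous function y : J → ℝ satisfying y(t) = (z'(t)/Γ(α)) ∫_{t₀}^{t} (z(t) − z(s))^{α−1} z'(s) f(s, y(s)) ds for all t ∈ J. -/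
open Set Filter Topology MeasureTheory

section WeaklySingularKernel

variable {t₀ b α m C : ℝ} {z h : ℝ → ℝ}

theorem norm_weaklySingular_le (hα₁ : α < 1) (hm : 0 < m)
    (hz : ∀ s ∈ Icc t₀ b, ∀ t ∈ Icc t₀ b, s ≤ t → m * (t - s) ≤ z t - z s)
    (hC : ∀ s ∈ Icc t₀ b, ‖h s‖ ≤ C)
    {s t : ℝ} (hs : t₀ ≤ s) (hst : s < t) (ht : t ≤ b) :
    ‖(z t - z s) ^ (α - 1) * h s‖ ≤ m ^ (α - 1) * C * (t - s) ^ (α - 1) := by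
  have hsJ : s ∈ Icc t₀ b := ⟨hs, hst.le.trans ht⟩
  have htJ : t ∈ Icc t₀ b := ⟨hs.trans hst.le, ht⟩
  have hts : 0 < t - s := sub_pos.2 hst
  have hle := hz s hsJ t htJ hst.le
  have hpos : 0 < m * (t - s) := mul_pos hm hts
  have hrpow : (z t - z s) ^ (α - 1) ≤ m ^ (α - 1) * (t - s) ^ (α - 1) := by
    rw [← Real.mul_rpow hm.le hts.le]
    exact Real.rpow_le_rpow_of_nonpos hpos hle (by linarith)
  rw [norm_mul, Real.norm_of_nonneg (Real.rpow_nonneg (hpos.le.trans hle) _)]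
  calc (z t - z s) ^ (α - 1) * ‖h s‖
      ≤ (m ^ (α - 1) * (t - s) ^ (α - 1)) * C :=
        mul_le_mul hrpow (hC s hsJ) (norm_nonneg _) (by positivity)
    _ = _ := by ring

theorem sub_pos_of_mul_sub_le (hm : 0 < m)
    (hz : ∀ s ∈ Icc t₀ b, ∀ t ∈ Icc t₀ b, s ≤ t → m * (t - s) ≤ z t - z s)
    {s t : ℝ} (hs : t₀ ≤ s) (hst : s < t) (ht : t ≤ b) : 0 < z t - z s :=
  (mul_pos hm (sub_pos.2 hst)).trans_le
    (hz s ⟨hs, hst.le.trans ht⟩ t ⟨hs.trans hst.le, ht⟩ hst.le)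

theorem intervalIntegrable_const_sub_rpow (hα₀ : 0 < α) (t₀ t : ℝ) :
    IntervalIntegrable (fun s => (t - s) ^ (α - 1)) volume t₀ t := by
  simpa using (intervalIntegral.intervalIntegrable_rpow' (a := t - t₀) (b := 0)
    (r := α - 1) (by linarith)).comp_sub_left t

theorem intervalIntegrable_weaklySingular (hα₀ : 0 < α) (hα₁ : α < 1) (hm : 0 < m)
    (hz : ∀ s ∈ Icc t₀ b, ∀ t ∈ Icc t₀ b, s ≤ t → m * (t - s) ≤ z t - z s)
    (hzc : ContinuousOn z (Icc t₀ b)) (hh : ContinuousOn h (Icc t₀ b))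
    {t : ℝ} (ht : t ∈ Icc t₀ b) :
    IntervalIntegrable (fun s => (z t - z s) ^ (α - 1) * h s) volume t₀ t := by
  obtain ⟨C, hC⟩ := isCompact_Icc.exists_bound_of_continuousOn hh
  have hsub : Ioo t₀ t ⊆ Icc t₀ b := fun s hs => ⟨hs.1.le, hs.2.le.trans ht.2⟩
  refine ((intervalIntegrable_const_sub_rpow hα₀ t₀ t).const_mul
    (m ^ (α - 1) * C)).mono_fun' ?_ ?_
  · rw [uIoc_of_le ht.1, ← restrict_Ioo_eq_restrict_Ioc]
    refine ContinuousOn.aestronglyMeasurable ?_ measurableSet_Ioo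
    exact ((continuousOn_const.sub (hzc.mono hsub)).rpow_const fun s hs =>
      Or.inl (sub_pos_of_mul_sub_le hm hz hs.1.le hs.2 ht.2).ne').mul (hh.mono hsub)
  · rw [uIoc_of_le ht.1, ← restrict_Ioo_eq_restrict_Ioc]
    filter_upwards [ae_restrict_mem measurableSet_Ioo] with s hs
    exact norm_weaklySingular_le hα₁ hm hz hC hs.1.le hs.2 ht.2

theorem norm_rescaled_weaklySingular_le (hα₀ : 0 < α) (hα₁ : α < 1) (hm : 0 < m)
    (hz : ∀ s ∈ Icc t₀ b, ∀ t ∈ Icc t₀ b, s ≤ t → m * (t - s) ≤ z t - z s)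
    (hC : ∀ s ∈ Icc t₀ b, ‖h s‖ ≤ C)
    {t τ : ℝ} (ht : t ∈ Icc t₀ b) (hτ : τ ∈ Ioo (0 : ℝ) 1) :
    ‖(t - t₀) * ((z t - z (t₀ + (t - t₀) * τ)) ^ (α - 1) * h (t₀ + (t - t₀) * τ))‖ ≤
      m ^ (α - 1) * C * (1 - τ) ^ (α - 1) * (t - t₀) ^ α := by
  rcases ht.1.eq_or_lt with rfl | hlt
  · simp [hα₀.ne']
  have hc : 0 < t - t₀ := sub_pos.2 hlt
  have hτ' : 0 < 1 - τ := sub_pos.2 hτ.2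
  have hs : t₀ ≤ t₀ + (t - t₀) * τ := by nlinarith [mul_pos hc hτ.1]
  have hst : t₀ + (t - t₀) * τ < t := by nlinarith [mul_pos hc hτ']
  have key := norm_weaklySingular_le hα₁ hm hz hC hs hst ht.2
  rw [show t - (t₀ + (t - t₀) * τ) = (t - t₀) * (1 - τ) by ring,
    Real.mul_rpow hc.le hτ'.le] at key
  rw [norm_mul, Real.norm_of_nonneg hc.le]
  refine (mul_le_mul_of_nonneg_left key hc.le).trans_eq ?_
  have : (t - t₀) ^ α = (t - t₀) * (t - t₀) ^ (α - 1) := by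
    rw [Real.rpow_sub_one hc.ne']; field_simp
  rw [this]; ring

theorem continuousOn_integral_weaklySingular (hα₀ : 0 < α) (hα₁ : α < 1) (hm : 0 < m)
    (hz : ∀ s ∈ Icc t₀ b, ∀ t ∈ Icc t₀ b, s ≤ t → m * (t - s) ≤ z t - z s)
    (hzc : ContinuousOn z (Icc t₀ b)) (hh : ContinuousOn h (Icc t₀ b)) :
    ContinuousOn (fun t => ∫ s in t₀..t, (z t - z s) ^ (α - 1) * h s) (Icc t₀ b) := by
  obtain ⟨C, hC⟩ := isCompact_Icc.exists_bound_of_continuousOn hh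
  let F : ℝ → ℝ → ℝ := fun t τ =>
    (t - t₀) * ((z t - z (t₀ + (t - t₀) * τ)) ^ (α - 1) * h (t₀ + (t - t₀) * τ))
  have hF : ∀ t, (∫ s in t₀..t, (z t - z s) ^ (α - 1) * h s) = ∫ τ in (0 : ℝ)..1, F t τ := by
    intro t
    have := intervalIntegral.mul_integral_comp_add_mul (a := 0) (b := 1)
      (f := fun s => (z t - z s) ^ (α - 1) * h s) (c := t - t₀) (d := t₀)
    simp only [mul_zero, add_zero, mul_one, add_sub_cancel] at this
    rw [← this, ← intervalIntegral.integral_const_mul]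
  simp only [hF]
  have hmaps : ∀ t ∈ Icc t₀ b, ∀ τ ∈ Ioo (0 : ℝ) 1, t₀ + (t - t₀) * τ ∈ Icc t₀ b := by
    intro t ht τ hτ
    have h1 := mul_nonneg (sub_nonneg.2 ht.1) hτ.1.le
    have h2 := mul_nonneg (sub_nonneg.2 ht.1) (sub_nonneg.2 hτ.2.le)
    constructor <;> nlinarith [ht.2]
  have hpos : ∀ t ∈ Icc t₀ b, t₀ < t → ∀ τ ∈ Ioo (0 : ℝ) 1,
      0 < z t - z (t₀ + (t - t₀) * τ) := by
    intro t ht hlt τ hτ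
    refine sub_pos_of_mul_sub_le hm hz (hmaps t ht τ hτ).1 ?_ ht.2
    nlinarith [mul_pos (sub_pos.2 hlt) (sub_pos.2 hτ.2)]
  have hC₀ : ∀ t ∈ Icc t₀ b, 0 ≤ C := fun t ht => (norm_nonneg _).trans (hC t ht)
  intro t ht
  refine intervalIntegral.continuousWithinAt_of_dominated_interval
    (bound := fun τ => m ^ (α - 1) * C * (1 - τ) ^ (α - 1) * (b - t₀) ^ α) ?_ ?_ ?_ ?_
  · filter_upwards [self_mem_nhdsWithin] with r hr
    rw [uIoc_of_le zero_le_one, ← restrict_Ioo_eq_restrict_Ioc]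
    refine ContinuousOn.aestronglyMeasurable ?_ measurableSet_Ioo
    rcases hr.1.eq_or_lt with heq | hlt
    · have : F r = fun _ => 0 := by ext τ; simp [F, ← heq]
      rw [this]; exact continuousOn_const
    have haff : ContinuousOn (fun τ : ℝ => t₀ + (r - t₀) * τ) (Ioo 0 1) := by fun_prop
    exact continuousOn_const.mul (((continuousOn_const.sub
      (hzc.comp haff (hmaps r hr))).rpow_const fun τ hτ => Or.inl (hpos r hr hlt τ hτ).ne').mul
      (hh.comp haff (hmaps r hr)))
  · filter_upwards [self_mem_nhdsWithin] with r hr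
    filter_upwards [Measure.ae_ne volume (1 : ℝ)] with τ hτ1 hτ
    rw [uIoc_of_le zero_le_one] at hτ
    have hτ' : τ ∈ Ioo (0 : ℝ) 1 := ⟨hτ.1, lt_of_le_of_ne hτ.2 hτ1⟩
    refine (norm_rescaled_weaklySingular_le hα₀ hα₁ hm hz hC hr hτ').trans ?_
    have h1 : 0 ≤ (1 - τ) ^ (α - 1) := Real.rpow_nonneg (sub_nonneg.2 hτ.2) _
    have h2 := hC₀ r hr
    refine mul_le_mul_of_nonneg_left ?_ (by positivity)
    exact Real.rpow_le_rpow (sub_nonneg.2 hr.1) (by linarith [hr.2]) hα₀.le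
  · exact ((intervalIntegrable_const_sub_rpow hα₀ 0 1).const_mul _).mul_const _
  · filter_upwards [Measure.ae_ne volume (1 : ℝ)] with τ hτ1 hτ
    rw [uIoc_of_le zero_le_one] at hτ
    have hτ' : τ ∈ Ioo (0 : ℝ) 1 := ⟨hτ.1, lt_of_le_of_ne hτ.2 hτ1⟩
    rcases ht.1.eq_or_lt with rfl | hlt
    · have hlim : Tendsto (fun r => m ^ (α - 1) * C * (1 - τ) ^ (α - 1) * (r - t₀) ^ α)
          (𝓝[Icc t₀ b] t₀) (𝓝 0) := by
        have : Continuous (fun r => m ^ (α - 1) * C * (1 - τ) ^ (α - 1) * (r - t₀) ^ α) :=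
          continuous_const.mul ((continuous_id.sub continuous_const).rpow_const
            fun _ => Or.inr hα₀.le)
        simpa [hα₀.ne'] using (this.tendsto t₀).mono_left (nhdsWithin_le_nhds (s := Icc t₀ b))
      have h0 : F t₀ τ = 0 := by simp [F]
      rw [ContinuousWithinAt, h0]
      refine squeeze_zero_norm' ?_ hlim
      filter_upwards [self_mem_nhdsWithin] with r hr
      exact norm_rescaled_weaklySingular_le hα₀ hα₁ hm hz hC hr hτ'
    · have haff : ContinuousOn (fun r : ℝ => t₀ + (r - t₀) * τ) (Icc t₀ b) := by fun_prop
      have hmaps' : MapsTo (fun r : ℝ => t₀ + (r - t₀) * τ) (Icc t₀ b) (Icc t₀ b) :=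
        fun r hr => hmaps r hr τ hτ'
      have hid : ContinuousWithinAt (fun r : ℝ => r - t₀) (Icc t₀ b) t := by fun_prop
      exact hid.mul ((((hzc t ht).sub (hzc.comp haff hmaps' t ht)).rpow_const
        (Or.inl (hpos t ht hlt τ hτ').ne')).mul (hh.comp haff hmaps' t ht))

end WeaklySingularKernel

/-- Contraction principle on `C(J, ℝ)` for an operator acting on functions `ℝ → ℝ` which only
depends on the values of its argument on `J`. -/
theorem exists_unique_fixedPoint_on_Icc {c d : ℝ} (hcd : c ≤ d) (T : (ℝ → ℝ) → ℝ → ℝ) {q : ℝ}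
    (hq₀ : 0 ≤ q) (hq₁ : q < 1)
    (hT : ∀ y, ContinuousOn y (Icc c d) → ContinuousOn (T y) (Icc c d))
    (hdist : ∀ y w, ContinuousOn y (Icc c d) → ContinuousOn w (Icc c d) → ∀ D,
      (∀ t ∈ Icc c d, |y t - w t| ≤ D) → ∀ t ∈ Icc c d, |T y t - T w t| ≤ q * D) :
    ∃ y : ℝ → ℝ, (ContinuousOn y (Icc c d) ∧ ∀ t ∈ Icc c d, y t = T y t) ∧
      ∀ w : ℝ → ℝ, (ContinuousOn w (Icc c d) ∧ ∀ t ∈ Icc c d, w t = T w t) →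
        ∀ t ∈ Icc c d, w t = y t := by
  have hext : ∀ y : C(Icc c d, ℝ), ContinuousOn (IccExtend hcd y) (Icc c d) :=
    fun y => y.continuous.Icc_extend'.continuousOn
  let S : C(Icc c d, ℝ) → C(Icc c d, ℝ) := fun y =>
    ⟨(Icc c d).domRestrict (T (IccExtend hcd y)), (hT _ (hext y)).domRestrict⟩
  have hS : ContractingWith ⟨q, hq₀⟩ S := by
    refine ⟨hq₁, LipschitzWith.of_dist_le_mul fun y w => ?_⟩
    refine (ContinuousMap.dist_le (by positivity)).2 fun t => ?_
    refine hdist _ _ (hext y) (hext w) (dist y w) (fun s hs => ?_) t t.2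
    rw [IccExtend_of_mem _ _ hs, IccExtend_of_mem _ _ hs]
    exact ContinuousMap.dist_apply_le_dist (f := y) (g := w) ⟨s, hs⟩
  have hfix := hS.fixedPoint_isFixedPt
  set y := hS.fixedPoint S
  have hy : ∀ t ∈ Icc c d, IccExtend hcd y t = T (IccExtend hcd y) t := by
    intro t ht
    rw [IccExtend_of_mem _ _ ht]
    exact (DFunLike.congr_fun hfix ⟨t, ht⟩).symm
  refine ⟨IccExtend hcd y, ⟨hext y, hy⟩, fun w ⟨hwc, hw⟩ t ht => ?_⟩
  obtain ⟨r, hr, hmax⟩ := isCompact_Icc.exists_isMaxOn (nonempty_Icc.2 hcd)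
    (hwc.sub (hext y)).abs
  have hle := hdist w _ hwc (hext y) _ (fun s hs => hmax hs) r hr
  rw [← hw r hr, ← hy r hr] at hle
  have h0 : |w r - IccExtend hcd y r| ≤ 0 := by
    simp only [Pi.sub_apply] at hle
    nlinarith [abs_nonneg (w r - IccExtend hcd y r)]
  have : |w t - IccExtend hcd y t| ≤ 0 := (hmax ht).trans h0
  exact sub_eq_zero.1 (abs_nonpos_iff.1 this)


/-- the paper's Theorem 3.5, case `𝕋 = ℝ`: under a Lipschitz
condition on `f` and the contraction condition
`sup_{t ∈ J} L z'(t) M_α(t) (t − t₀)/Γ α < 1`, the integral equation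
`y t = (z' t / Γ α) ∫_{t₀}^{t} (z t − z s)^(α−1) z' s · f s (y s) ds`
has a unique continuous solution on `J`. -/
theorem existence_uniqueness_banach
    (t₀ a α : ℝ) (ha : 0 < a) (hα₀ : 0 < α) (hα₁ : α < 1)
    (z z' : ℝ → ℝ)
    (hz_deriv : ∀ t ∈ Set.Icc t₀ (t₀ + a), HasDerivAt z (z' t) t)
    (hz'_cont : ContinuousOn z' (Set.Icc t₀ (t₀ + a)))
    (hz_mono : StrictMonoOn z (Set.Icc t₀ (t₀ + a)))
    (hz'_pos : ∀ t ∈ Set.Icc t₀ (t₀ + a), 0 < z' t)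
    (f : ℝ → ℝ → ℝ)
    (hf : ContinuousOn (fun p : ℝ × ℝ => f p.1 p.2) (Set.Icc t₀ (t₀ + a) ×ˢ Set.univ))
    (L : ℝ) (hL : 0 < L)
    (hLip : ∀ t ∈ Set.Icc t₀ (t₀ + a), ∀ u v : ℝ, |f t u - f t v| ≤ L * |u - v|)
    (Mα : ℝ → ℝ)
    (hMα : ∀ t : ℝ, Mα t =
      (∫ s in t₀..t, (z t - z s) ^ (α - 1) * z' s) / (t - t₀))
    (hcontraction :
      (⨆ t : Set.Icc t₀ (t₀ + a),
        L * z' t * Mα t * ((t : ℝ) - t₀) / Real.Gamma α) < 1) :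
    ∃ y : ℝ → ℝ,
      (ContinuousOn y (Set.Icc t₀ (t₀ + a)) ∧
        ∀ t ∈ Set.Icc t₀ (t₀ + a),
          y t = z' t / Real.Gamma α *
            ∫ s in t₀..t, (z t - z s) ^ (α - 1) * z' s * f s (y s)) ∧
      ∀ w : ℝ → ℝ,
        (ContinuousOn w (Set.Icc t₀ (t₀ + a)) ∧
          ∀ t ∈ Set.Icc t₀ (t₀ + a),
            w t = z' t / Real.Gamma α *
              ∫ s in t₀..t, (z t - z s) ^ (α - 1) * z' s * f s (w s)) →
        ∀ t ∈ Set.Icc t₀ (t₀ + a), w t = y t := by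
  set J := Icc t₀ (t₀ + a)
  have h₀J : t₀ ∈ J := ⟨le_rfl, by linarith⟩
  have hΓ : 0 < Real.Gamma α := Real.Gamma_pos_of_pos hα₀
  have hzc : ContinuousOn z J := fun t ht => (hz_deriv t ht).continuousAt.continuousWithinAt
  obtain ⟨r, hr, hmin⟩ := isCompact_Icc.exists_isMinOn ⟨t₀, h₀J⟩ hz'_cont
  have hm : 0 < z' r := hz'_pos r hr
  have hz : ∀ s ∈ J, ∀ t ∈ J, s ≤ t → z' r * (t - s) ≤ z t - z s :=
    (convex_Icc _ _).mul_sub_le_image_sub_of_le_deriv hzc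
      (fun t ht => (hz_deriv t (interior_subset ht)).differentiableAt.differentiableWithinAt)
      fun t ht => by
        rw [(hz_deriv t (interior_subset ht)).deriv]
        exact hmin (interior_subset ht)
  have hfy : ∀ y, ContinuousOn y J → ContinuousOn (fun s => z' s * f s (y s)) J := fun y hy =>
    hz'_cont.mul (hf.comp (continuousOn_id.prodMk hy) fun s hs => ⟨hs, mem_univ _⟩)
  have hint : ∀ y, ContinuousOn y J → ∀ t ∈ J, IntervalIntegrable
      (fun s => (z t - z s) ^ (α - 1) * z' s * f s (y s)) volume t₀ t := fun y hy t ht => by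
    simpa only [mul_assoc] using
      intervalIntegrable_weaklySingular hα₀ hα₁ hm hz hzc (hfy y hy) ht
  have hfactor : ContinuousOn (fun t => z' t / Real.Gamma α) J := hz'_cont.div_const _
  have hM : ∀ t, L * z' t * Mα t * (t - t₀) / Real.Gamma α =
      L * (z' t / Real.Gamma α * ∫ s in t₀..t, (z t - z s) ^ (α - 1) * z' s) := by
    intro t
    rw [hMα]
    rcases eq_or_ne t t₀ with rfl | hne
    · simp
    · have := sub_ne_zero.2 hne
      field_simp
  have hbdd : BddAbove (range fun t : J =>
      L * z' t * Mα t * ((t : ℝ) - t₀) / Real.Gamma α) := by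
    have hcont : ContinuousOn (fun t => L * z' t * Mα t * (t - t₀) / Real.Gamma α) J := by
      simp only [hM]
      exact continuousOn_const.mul (hfactor.mul
        (continuousOn_integral_weaklySingular hα₀ hα₁ hm hz hzc hz'_cont))
    simpa only [image_eq_range] using isCompact_Icc.bddAbove_image hcont
  have hq : ∀ t ∈ J, L * (z' t / Real.Gamma α * ∫ s in t₀..t, (z t - z s) ^ (α - 1) * z' s) ≤
      ⨆ t : J, L * z' t * Mα t * ((t : ℝ) - t₀) / Real.Gamma α := fun t ht => by
    rw [← hM]
    exact le_ciSup hbdd ⟨t, ht⟩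
  refine exists_unique_fixedPoint_on_Icc (by linarith)
    (fun y t => z' t / Real.Gamma α * ∫ s in t₀..t, (z t - z s) ^ (α - 1) * z' s * f s (y s))
    (by simpa using hq t₀ h₀J) hcontraction ?_ ?_
  · intro y hy
    have := continuousOn_integral_weaklySingular hα₀ hα₁ hm hz hzc (hfy y hy)
    simp only [← mul_assoc] at this
    exact hfactor.mul this
  · intro y w hy hw D hD t ht
    have hD₀ : 0 ≤ D := (abs_nonneg _).trans (hD t ht)
    have hz't : 0 ≤ z' t / Real.Gamma α := (div_pos (hz'_pos t ht) hΓ).le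
    have hkernel := intervalIntegrable_weaklySingular hα₀ hα₁ hm hz hzc hz'_cont ht
    have hdiff : |∫ s in t₀..t, ((z t - z s) ^ (α - 1) * z' s * f s (y s) -
        (z t - z s) ^ (α - 1) * z' s * f s (w s))| ≤
        ∫ s in t₀..t, (z t - z s) ^ (α - 1) * z' s * (L * D) := by
      rw [← Real.norm_eq_abs]
      refine intervalIntegral.norm_integral_le_of_norm_le ht.1
        (Eventually.of_forall fun s hs => ?_) (hkernel.mul_const _)
      have hsJ : s ∈ J := ⟨hs.1.le, hs.2.trans ht.2⟩
      have hk : 0 ≤ (z t - z s) ^ (α - 1) * z' s :=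
        mul_nonneg (Real.rpow_nonneg (sub_nonneg.2 (hz_mono.monotoneOn hsJ ht hs.2)) _)
          (hz'_pos s hsJ).le
      rw [← mul_sub, norm_mul, Real.norm_of_nonneg hk]
      exact mul_le_mul_of_nonneg_left ((hLip s hsJ _ _).trans
        (mul_le_mul_of_nonneg_left (hD s hsJ) hL.le)) hk
    rw [intervalIntegral.integral_sub (hint y hy t ht) (hint w hw t ht),
      intervalIntegral.integral_mul_const] at hdiff
    rw [← mul_sub, abs_mul, abs_of_nonneg hz't]
    calc _ ≤ _ := mul_le_mul_of_nonneg_left hdiff hz't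
      _ = L * (z' t / Real.Gamma α * ∫ s in t₀..t, (z t - z s) ^ (α - 1) * z' s) * D := by ring
      _ ≤ _ := mul_le_mul_of_nonneg_right (hq t ht) hD₀
end

section
/- Let t₀ ∈ ℝ, a > 0, J = [t₀, t₀ + a], and let 0 < α < 1. Let z : ℝ → ℝ be continuously differentiable and strictly increasing on J with z'(t) > 0 for all t ∈ J, and let f : J × ℝ → ℝ be continuous. Then the operator F : C(J, ℝ) → C(J, ℝ) defined by F(y)(t) = (z'(t)/Γ(α)) ∫_{t₀}^{t} (z(t) − z(s))^{α−1} z'(s) f(s, y(s)) ds is well defined (F(y) is continuous on J for every continuous y) and is continuous with respect to the supremum norm: if y_n → y uniformly on J, then F(y_n) → F(y) uniformly on J. -/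
open Set Filter Topology MeasureTheory BoundedContinuousFunction

/-- A continuous function on `[a, b]` factors through any continuous injection of `[a, b]` into `ℝ`
as a bounded continuous function on `ℝ`. -/
lemma exists_boundedContinuous_comp_eqOn {a b : ℝ} {z g : ℝ → ℝ}
    (hz : ContinuousOn z (Icc a b)) (hz_inj : InjOn z (Icc a b)) (hg : ContinuousOn g (Icc a b)) :
    ∃ h : ℝ →ᵇ ℝ, ∀ s ∈ Icc a b, h (z s) = g s := by
  obtain ⟨h, -, hh⟩ := exists_extension_norm_eq_of_isClosedEmbedding
    (mkOfCompact ⟨(Icc a b).domRestrict g, hg.domRestrict⟩)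
    (hz.domRestrict.isClosedEmbedding hz_inj.injective)
  exact ⟨h, fun s hs => congrFun hh ⟨s, hs⟩⟩

lemma intervalIntegrable_rpow_mul_comp_sub {r : ℝ} (hr : -1 < r) (h : ℝ →ᵇ ℝ) (T a b : ℝ) :
    IntervalIntegrable (fun v => v ^ r * h (T - v)) volume a b :=
  (intervalIntegral.intervalIntegrable_rpow' hr).mul_continuousOn (by fun_prop)

lemma continuous_integral_rpow_mul_comp_sub {r : ℝ} (hr : -1 < r) (h : ℝ →ᵇ ℝ) (c : ℝ) :
    Continuous fun T => ∫ v in (0 : ℝ)..(T - c), v ^ r * h (T - v) := by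
  refine continuous_iff_continuousAt.2 fun T => ?_
  have key : ContinuousAt (fun p : ℝ × ℝ => ∫ v in (0 : ℝ)..p.2, v ^ r * h (p.1 - v))
      (T, T - c) := by
    refine intervalIntegral.continuousAt_parametric_primitive_of_dominated
      (F := fun T v => v ^ r * h (T - v)) (fun v => ‖v ^ r‖ * ‖h‖)
      (-1 - |T - c|) (1 + |T - c|) (fun x => ?_) ?_ ?_ ?_ ?_ ?_ (by simp)
    · exact (Measurable.mul (by fun_prop) (by fun_prop)).aestronglyMeasurable
    · refine .of_forall fun x => .of_forall fun v => ?_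
      rw [norm_mul]
      gcongr
      exact h.norm_coe_le_norm _
    · exact (intervalIntegral.intervalIntegrable_rpow' hr).norm.mul_const _
    · exact .of_forall fun v => by fun_prop
    · constructor <;> linarith [abs_nonneg (T - c)]
    · constructor <;> linarith [neg_abs_le (T - c), le_abs_self (T - c)]
  exact ContinuousAt.comp (f := fun T : ℝ => (T, T - c)) key (by fun_prop)

lemma abs_integral_rpow_mul_le {r d ε : ℝ} (hr : -1 < r) (hd : 0 ≤ d) {q : ℝ → ℝ}
    (hq : ∀ v ∈ Icc 0 d, |q v| ≤ ε) :
    |∫ v in (0 : ℝ)..d, v ^ r * q v| ≤ d ^ (r + 1) / (r + 1) * ε := by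
  have hI : ∫ v in (0 : ℝ)..d, v ^ r * ε = d ^ (r + 1) / (r + 1) * ε := by
    rw [intervalIntegral.integral_mul_const, integral_rpow (Or.inl hr),
      Real.zero_rpow (by linarith), sub_zero]
  rw [← hI, ← Real.norm_eq_abs]
  refine intervalIntegral.norm_integral_le_of_norm_le hd (.of_forall fun v hv => ?_)
    ((intervalIntegral.intervalIntegrable_rpow' hr).mul_const _)
  rw [norm_mul, Real.norm_of_nonneg (Real.rpow_nonneg hv.1.le r)]
  exact mul_le_mul_of_nonneg_left (hq v (Ioc_subset_Icc_self hv)) (Real.rpow_nonneg hv.1.le r)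

/-- The substitution `v = z t - z s` in a weakly singular integral. -/
lemma integral_rpow_sub_mul_deriv_mul {a t r : ℝ} (hat : a ≤ t) {z z' g h : ℝ → ℝ}
    (hz : ∀ s ∈ Icc a t, HasDerivAt z (z' s) s) (hz' : ∀ s ∈ Icc a t, 0 ≤ z' s)
    (hza : z a ≤ z t) (hh : ∀ s ∈ Icc a t, h (z s) = g s) :
    ∫ s in a..t, (z t - z s) ^ r * z' s * g s =
      ∫ v in (0 : ℝ)..(z t - z a), v ^ r * h (z t - v) := by
  calc ∫ s in a..t, (z t - z s) ^ r * z' s * g s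
      = ∫ s in Icc a t, z' s • ((z t - z s) ^ r * h (z s)) := by
        rw [intervalIntegral.integral_of_le hat, ← integral_Icc_eq_integral_Ioc]
        refine setIntegral_congr_fun measurableSet_Icc fun s hs => ?_
        simp only [hh s hs, smul_eq_mul]
        ring
    _ = ∫ u in z a..z t, (z t - u) ^ r * h u := by
        rw [integral_Icc_deriv_smul_of_deriv_nonneg (g := fun u => (z t - u) ^ r * h u)
          (fun s hs => (hz s hs).continuousAt.continuousWithinAt)
          (fun s hs => hz s (Ioo_subset_Icc_self hs))
          (fun s hs => hz' s (Ioo_subset_Icc_self hs)) hat,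
          intervalIntegral.integral_of_le hza, integral_Icc_eq_integral_Ioc]
    _ = _ := by
        have := intervalIntegral.integral_comp_sub_left (a := 0) (b := z t - z a)
          (fun u => (z t - u) ^ r * h u) (z t)
        simpa using this.symm

lemma continuousOn_integral_rpow_sub_mul_deriv_mul {a b r : ℝ} (hr : -1 < r) {z z' g : ℝ → ℝ}
    (hz : ∀ s ∈ Icc a b, HasDerivAt z (z' s) s) (hz' : ∀ s ∈ Icc a b, 0 ≤ z' s)
    (hz_mono : StrictMonoOn z (Icc a b)) (hg : ContinuousOn g (Icc a b)) :
    ContinuousOn (fun t => ∫ s in a..t, (z t - z s) ^ r * z' s * g s) (Icc a b) := by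
  have hzc : ContinuousOn z (Icc a b) := fun s hs => (hz s hs).continuousAt.continuousWithinAt
  obtain ⟨h, hh⟩ := exists_boundedContinuous_comp_eqOn hzc hz_mono.injOn hg
  refine ((continuous_integral_rpow_mul_comp_sub hr h (z a)).comp_continuousOn hzc).congr
    fun t ht => ?_
  have hsub : Icc a t ⊆ Icc a b := Icc_subset_Icc_right ht.2
  exact integral_rpow_sub_mul_deriv_mul ht.1 (fun s hs => hz s (hsub hs))
    (fun s hs => hz' s (hsub hs))
    (hz_mono.monotoneOn (left_mem_Icc.2 (ht.1.trans ht.2)) ht ht.1) (fun s hs => hh s (hsub hs))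

lemma abs_integral_rpow_sub_mul_deriv_mul_sub_le {a b r ε : ℝ} (hr : -1 < r)
    {z z' g₁ g₂ : ℝ → ℝ}
    (hz : ∀ s ∈ Icc a b, HasDerivAt z (z' s) s) (hz' : ∀ s ∈ Icc a b, 0 ≤ z' s)
    (hz_mono : StrictMonoOn z (Icc a b)) (hg₁ : ContinuousOn g₁ (Icc a b))
    (hg₂ : ContinuousOn g₂ (Icc a b)) (hε : ∀ s ∈ Icc a b, |g₁ s - g₂ s| ≤ ε)
    {t : ℝ} (ht : t ∈ Icc a b) :
    |(∫ s in a..t, (z t - z s) ^ r * z' s * g₁ s) - ∫ s in a..t, (z t - z s) ^ r * z' s * g₂ s|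
      ≤ (z b - z a) ^ (r + 1) / (r + 1) * ε := by
  have hab : a ≤ b := ht.1.trans ht.2
  have hzc : ContinuousOn z (Icc a b) := fun s hs => (hz s hs).continuousAt.continuousWithinAt
  obtain ⟨h₁, hh₁⟩ := exists_boundedContinuous_comp_eqOn hzc hz_mono.injOn hg₁
  obtain ⟨h₂, hh₂⟩ := exists_boundedContinuous_comp_eqOn hzc hz_mono.injOn hg₂
  have hsub : Icc a t ⊆ Icc a b := Icc_subset_Icc_right ht.2
  have hza : z a ≤ z t := hz_mono.monotoneOn (left_mem_Icc.2 hab) ht ht.1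
  have hzb : z t ≤ z b := hz_mono.monotoneOn ht (right_mem_Icc.2 hab) ht.2
  have hε₀ : 0 ≤ ε := (abs_nonneg _).trans (hε t ht)
  rw [integral_rpow_sub_mul_deriv_mul ht.1 (fun s hs => hz s (hsub hs))
      (fun s hs => hz' s (hsub hs)) hza (fun s hs => hh₁ s (hsub hs)),
    integral_rpow_sub_mul_deriv_mul ht.1 (fun s hs => hz s (hsub hs))
      (fun s hs => hz' s (hsub hs)) hza (fun s hs => hh₂ s (hsub hs)),
    ← intervalIntegral.integral_sub (intervalIntegrable_rpow_mul_comp_sub hr h₁ _ _ _)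
      (intervalIntegrable_rpow_mul_comp_sub hr h₂ _ _ _)]
  simp only [← mul_sub]
  refine (abs_integral_rpow_mul_le hr (sub_nonneg.2 hza)
    (q := fun v => h₁ (z t - v) - h₂ (z t - v)) (ε := ε) fun v hv => ?_).trans ?_
  · obtain ⟨s, hs, hzs⟩ := intermediate_value_Icc ht.1 (hzc.mono hsub)
      (show z t - v ∈ Icc (z a) (z t) from ⟨by linarith [hv.2], by linarith [hv.1]⟩)
    rw [← hzs, hh₁ s (hsub hs), hh₂ s (hsub hs)]
    exact hε s (hsub hs)
  · have hr' : 0 < r + 1 := by linarith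
    have : 0 ≤ z t - z a := sub_nonneg.2 hza
    gcongr

/-- A Nemytskii operator `y ↦ f(·, y(·))` with continuous `f` preserves uniform convergence on
compact sets towards a continuous function. -/
lemma tendstoUniformlyOn_nemytskii {X ι : Type*} [PseudoMetricSpace X] {K : Set X} (hK : IsCompact K)
    {f : X → ℝ → ℝ} (hf : ContinuousOn (fun p : X × ℝ => f p.1 p.2) (K ×ˢ univ))
    {l : Filter ι} {Y : ι → X → ℝ} {y : X → ℝ} (hy : ContinuousOn y K)
    (hY : TendstoUniformlyOn Y y l K) :
    TendstoUniformlyOn (fun n s => f s (Y n s)) (fun s => f s (y s)) l K := by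
  obtain ⟨M, hM⟩ := hK.exists_bound_of_continuousOn hy
  have hpair : TendstoUniformlyOn (fun n s => (s, Y n s)) (fun s => (s, y s)) l K := by
    rw [Metric.tendstoUniformlyOn_iff] at hY ⊢
    simpa [Prod.dist_eq] using hY
  refine UniformContinuousOn.comp_tendstoUniformlyOn_eventually
    (s := K ×ˢ Icc (-(M + 1)) (M + 1)) (g := fun p : X × ℝ => f p.1 p.2) ?_ ?_ ?_ hpair
  · filter_upwards [Metric.tendstoUniformlyOn_iff.1 hY 1 one_pos] with n hn s hs
    have h1 := hn s hs
    have h2 := hM s hs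
    rw [Real.dist_eq, abs_lt] at h1
    rw [Real.norm_eq_abs, abs_le] at h2
    exact ⟨hs, by linarith, by linarith⟩
  · intro s hs
    have h2 := hM s hs
    rw [Real.norm_eq_abs, abs_le] at h2
    exact ⟨hs, by linarith, by linarith⟩
  · exact (hK.prod isCompact_Icc).uniformContinuousOn_of_continuous
      (hf.mono (prod_mono_right (subset_univ _)))


/-- Step 1 of the proof of the paper's Theorem 3.6, case `𝕋 = ℝ`.
The operator `F(y)(t) = (z' t / Γ α) ∫_{t₀}^{t} (z t − z s)^(α−1) z' s · f s (y s) ds`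
is well defined on `C(J, ℝ)` (i.e. `F y` is continuous on `J` whenever `y` is) and is
continuous with respect to the supremum norm: if `yₙ → y` uniformly on `J`, then
`F yₙ → F y` uniformly on `J`. -/
theorem operator_well_defined_and_continuous
    (t₀ a α : ℝ) (ha : 0 < a) (hα₀ : 0 < α) (hα₁ : α < 1)
    (z z' : ℝ → ℝ)
    (hz_deriv : ∀ t ∈ Set.Icc t₀ (t₀ + a), HasDerivAt z (z' t) t)
    (hz'_cont : ContinuousOn z' (Set.Icc t₀ (t₀ + a)))
    (hz_mono : StrictMonoOn z (Set.Icc t₀ (t₀ + a)))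
    (hz'_pos : ∀ t ∈ Set.Icc t₀ (t₀ + a), 0 < z' t)
    (f : ℝ → ℝ → ℝ)
    (hf : ContinuousOn (fun p : ℝ × ℝ => f p.1 p.2) (Set.Icc t₀ (t₀ + a) ×ˢ Set.univ))
    (F : (ℝ → ℝ) → ℝ → ℝ)
    (hF : ∀ y : ℝ → ℝ, ∀ t : ℝ, F y t = z' t / Real.Gamma α *
      ∫ s in t₀..t, (z t - z s) ^ (α - 1) * z' s * f s (y s)) :
    (∀ y : ℝ → ℝ, ContinuousOn y (Set.Icc t₀ (t₀ + a)) →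
      ContinuousOn (F y) (Set.Icc t₀ (t₀ + a))) ∧
    (∀ (Y : ℕ → ℝ → ℝ) (y : ℝ → ℝ),
      (∀ n, ContinuousOn (Y n) (Set.Icc t₀ (t₀ + a))) →
      ContinuousOn y (Set.Icc t₀ (t₀ + a)) →
      TendstoUniformlyOn Y y Filter.atTop (Set.Icc t₀ (t₀ + a)) →
      TendstoUniformlyOn (fun n => F (Y n)) (F y) Filter.atTop
        (Set.Icc t₀ (t₀ + a))) := by
  have hr : -1 < α - 1 := by linarith
  have hz'_nonneg : ∀ t ∈ Icc t₀ (t₀ + a), 0 ≤ z' t := fun t ht => (hz'_pos t ht).le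
  have hcomp : ∀ y : ℝ → ℝ, ContinuousOn y (Icc t₀ (t₀ + a)) →
      ContinuousOn (fun s => f s (y s)) (Icc t₀ (t₀ + a)) := fun y hy =>
    hf.comp (continuousOn_id.prodMk hy) fun s hs => ⟨hs, mem_univ _⟩
  have hΓ : ContinuousOn (fun t => z' t / Real.Gamma α) (Icc t₀ (t₀ + a)) := hz'_cont.div_const _
  refine ⟨fun y hy => ?_, fun Y y hY hy hlim => ?_⟩
  · rw [show F y = _ from funext (hF y)]
    exact hΓ.mul (continuousOn_integral_rpow_sub_mul_deriv_mul hr hz_deriv hz'_nonneg hz_mono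
      (hcomp y hy))
  · obtain ⟨C, hC⟩ := isCompact_Icc.exists_bound_of_continuousOn hΓ
    have hC₀ : 0 ≤ C := (norm_nonneg _).trans (hC t₀ (left_mem_Icc.2 (by linarith)))
    set D := (z (t₀ + a) - z t₀) ^ (α - 1 + 1) / (α - 1 + 1)
    have hD : 0 ≤ D := div_nonneg (Real.rpow_nonneg (sub_nonneg.2 (hz_mono.monotoneOn
      (left_mem_Icc.2 (by linarith)) (right_mem_Icc.2 (by linarith)) (by linarith))) _)
      (by linarith)
    rw [Metric.tendstoUniformlyOn_iff]
    intro ε hε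
    have hδ : 0 < ε / (C * D + 1) := by positivity
    filter_upwards [Metric.tendstoUniformlyOn_iff.1
      (tendstoUniformlyOn_nemytskii isCompact_Icc hf hy hlim) _ hδ] with n hn t ht
    have hdiff := abs_integral_rpow_sub_mul_deriv_mul_sub_le hr hz_deriv hz'_nonneg hz_mono
      (hcomp y hy) (hcomp (Y n) (hY n)) (fun s hs => (hn s hs).le) ht
    rw [hF, hF, Real.dist_eq, ← mul_sub, abs_mul]
    calc _ ≤ C * (D * (ε / (C * D + 1))) :=
          mul_le_mul (hC t ht) hdiff (abs_nonneg _) hC₀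
      _ = C * D * ε / (C * D + 1) := by ring
      _ < ε := by
          rw [div_lt_iff₀ (by positivity)]
          linarith
end

section
/- Let t₀ ∈ ℝ, a > 0, J = [t₀, t₀ + a], and let 0 < α < 1. Let z : ℝ → ℝ be continuously differentiable and strictly increasing on J with z'(t) > 0 for all t ∈ J. Let f : J × ℝ → ℝ be continuous and suppose there exists N > 0 such that |f(t,u)| ≤ N for all t ∈ J and u ∈ ℝ. Then the family {F(y) : y ∈ C(J, ℝ)} is equicontinuous on J: for every ε > 0 there exists δ > 0 such that for all t₁, t₂ ∈ J with |t₂ − t₁| < δ and all continuous y : J → ℝ, |F(y)(t₂) − F(y)(t₁)| < ε. -/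
/-- The kernel `(z t - z s) ^ (α - 1) * z' s` is integrable on `[p, q]` up to its singularity at
`s = t`, and its integral is explicit. -/
lemma integral_rpow_sub_mul_deriv {α : ℝ} (hα : 0 < α) {z z' : ℝ → ℝ} {p q t : ℝ}
    (hpq : p ≤ q) (hqt : q ≤ t)
    (hz : ∀ s ∈ Set.Icc p t, HasDerivAt z (z' s) s) (hmono : StrictMonoOn z (Set.Icc p t))
    (hpos : ∀ s ∈ Set.Icc p t, 0 < z' s) :
    IntervalIntegrable (fun s => (z t - z s) ^ (α - 1) * z' s) MeasureTheory.volume p q ∧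
      ∫ s in p..q, (z t - z s) ^ (α - 1) * z' s =
        ((z t - z p) ^ α - (z t - z q) ^ α) / α := by
  have hsub : Set.Icc p q ⊆ Set.Icc p t := Set.Icc_subset_Icc_right hqt
  have hcont : ContinuousOn (fun s => -((z t - z s) ^ α / α)) (Set.Icc p q) := by
    have hzc : ContinuousOn z (Set.Icc p q) := fun s hs =>
      (hz s (hsub hs)).continuousAt.continuousWithinAt
    exact (((continuousOn_const.sub hzc).rpow_const fun _ _ => Or.inr hα.le).div_const α).neg
  have hpos_sub : ∀ s ∈ Set.Ioo p q, 0 < z t - z s := fun s hs =>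
    sub_pos.2 (hmono (hsub (Set.Ioo_subset_Icc_self hs)) ⟨hpq.trans hqt, le_rfl⟩
      (hs.2.trans_le hqt))
  have hderiv : ∀ s ∈ Set.Ioo p q, HasDerivAt (fun s => -((z t - z s) ^ α / α))
      ((z t - z s) ^ (α - 1) * z' s) s := by
    intro s hs
    have h := ((((hz s (hsub (Set.Ioo_subset_Icc_self hs))).const_sub (z t)).rpow_const
      (p := α) (Or.inl (hpos_sub s hs).ne')).div_const α).neg
    refine h.congr_deriv ?_
    field_simp
  have hnonneg : ∀ s ∈ Set.Ioo p q, 0 ≤ (z t - z s) ^ (α - 1) * z' s := fun s hs =>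
    mul_nonneg (Real.rpow_nonneg (hpos_sub s hs).le _)
      (hpos s (hsub (Set.Ioo_subset_Icc_self hs))).le
  have hint : IntervalIntegrable (fun s => (z t - z s) ^ (α - 1) * z' s)
      MeasureTheory.volume p q :=
    (intervalIntegrable_iff_integrableOn_Ioc_of_le hpq).2
      (intervalIntegral.integrableOn_deriv_of_nonneg hcont hderiv hnonneg)
  refine ⟨hint, ?_⟩
  rw [intervalIntegral.integral_eq_sub_of_hasDerivAt_of_le hpq hcont hderiv hint]
  ring

/-- A bounded continuous factor preserves interval integrability. -/
lemma IntervalIntegrable.mul_continuousOn_Icc {w g : ℝ → ℝ} {p q : ℝ} (hpq : p ≤ q)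
    (hw : IntervalIntegrable w MeasureTheory.volume p q) (hg : ContinuousOn g (Set.Icc p q)) :
    IntervalIntegrable (fun s => w s * g s) MeasureTheory.volume p q :=
  hw.mul_continuousOn (by rwa [Set.uIcc_of_le hpq])

/-- If `|g| ≤ N` and `w ≥ 0` inside `[p, q]`, then `|∫ w g| ≤ N ∫ w`. -/
lemma abs_integral_mul_le {w g : ℝ → ℝ} {p q N : ℝ} (hpq : p ≤ q)
    (hw : IntervalIntegrable w MeasureTheory.volume p q)
    (hnonneg : ∀ s ∈ Set.Icc p q, 0 ≤ w s) (hbound : ∀ s ∈ Set.Icc p q, |g s| ≤ N) :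
    |∫ s in p..q, w s * g s| ≤ N * ∫ s in p..q, w s := by
  rw [← intervalIntegral.integral_const_mul, ← Real.norm_eq_abs]
  refine intervalIntegral.norm_integral_le_of_norm_le hpq (.of_forall fun s hs => ?_)
    (hw.const_mul N)
  have hs' := Set.Ioc_subset_Icc_self hs
  rw [Real.norm_eq_abs, abs_mul, abs_of_nonneg (hnonneg s hs'), mul_comm]
  exact mul_le_mul_of_nonneg_right (hbound s hs') (hnonneg s hs')

/-- Bound for the fractional integral of a function bounded by `N`. -/
lemma abs_integral_rpow_sub_mul_le {α : ℝ} (hα : 0 < α) {z z' g : ℝ → ℝ} {p q t N : ℝ}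
    (hpq : p ≤ q) (hqt : q ≤ t)
    (hz : ∀ s ∈ Set.Icc p t, HasDerivAt z (z' s) s) (hmono : StrictMonoOn z (Set.Icc p t))
    (hpos : ∀ s ∈ Set.Icc p t, 0 < z' s) (hbound : ∀ s ∈ Set.Icc p t, |g s| ≤ N) :
    |∫ s in p..q, (z t - z s) ^ (α - 1) * z' s * g s| ≤
      N * (((z t - z p) ^ α - (z t - z q) ^ α) / α) := by
  obtain ⟨hint, heq⟩ := integral_rpow_sub_mul_deriv hα hpq hqt hz hmono hpos
  have hsub : Set.Icc p q ⊆ Set.Icc p t := Set.Icc_subset_Icc_right hqt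
  rw [← heq]
  refine abs_integral_mul_le hpq hint (fun s hs => ?_) fun s hs => hbound s (hsub hs)
  refine mul_nonneg (Real.rpow_nonneg (sub_nonneg.2 ?_) _) (hpos s (hsub hs)).le
  exact hmono.monotoneOn (hsub hs) ⟨hpq.trans hqt, le_rfl⟩ (hsub hs).2

/-- Hölder-type estimate for the increments of the fractional integral of order `α < 1`. -/
lemma abs_integral_rpow_sub_mul_sub_le {α : ℝ} (hα₀ : 0 < α) (hα₁ : α < 1) {z z' g : ℝ → ℝ}
    {c p q N : ℝ} (hcp : c ≤ p) (hpq : p ≤ q)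
    (hz : ∀ s ∈ Set.Icc c q, HasDerivAt z (z' s) s) (hmono : StrictMonoOn z (Set.Icc c q))
    (hpos : ∀ s ∈ Set.Icc c q, 0 < z' s) (hg : ContinuousOn g (Set.Icc c q)) (hN : 0 ≤ N)
    (hbound : ∀ s ∈ Set.Icc c q, |g s| ≤ N) :
    |(∫ s in c..q, (z q - z s) ^ (α - 1) * z' s * g s) -
        ∫ s in c..p, (z p - z s) ^ (α - 1) * z' s * g s| ≤
      2 * N * (z q - z p) ^ α / α := by
  have hsub : Set.Icc c p ⊆ Set.Icc c q := Set.Icc_subset_Icc_right hpq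
  have hsub' : Set.Icc p q ⊆ Set.Icc c q := Set.Icc_subset_Icc_left hcp
  obtain ⟨hint_p, heq_p⟩ := integral_rpow_sub_mul_deriv hα₀ hcp le_rfl
    (fun s hs => hz s (hsub hs)) (hmono.mono hsub) fun s hs => hpos s (hsub hs)
  obtain ⟨hint_q, heq_q⟩ := integral_rpow_sub_mul_deriv hα₀ hcp hpq hz hmono hpos
  obtain ⟨hint_pq, -⟩ := integral_rpow_sub_mul_deriv hα₀ hpq le_rfl
    (fun s hs => hz s (hsub' hs)) (hmono.mono hsub') fun s hs => hpos s (hsub' hs)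
  have htail := abs_integral_rpow_sub_mul_le hα₀ hpq le_rfl
    (fun s hs => hz s (hsub' hs)) (hmono.mono hsub') (fun s hs => hpos s (hsub' hs))
    fun s hs => hbound s (hsub' hs)
  have hgp := hg.mono hsub
  have hsplit := intervalIntegral.integral_add_adjacent_intervals
    (hint_q.mul_continuousOn_Icc hcp hgp) (hint_pq.mul_continuousOn_Icc hpq (hg.mono hsub'))
  have hdiff := intervalIntegral.integral_sub
    (hint_p.mul_continuousOn_Icc hcp hgp) (hint_q.mul_continuousOn_Icc hcp hgp)
  -- The kernel decreases in its first argument, so the difference of the kernels has a sign.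
  have hhead : |∫ s in c..p, ((z p - z s) ^ (α - 1) * z' s * g s -
      (z q - z s) ^ (α - 1) * z' s * g s)| ≤
      N * ∫ s in c..p, ((z p - z s) ^ (α - 1) * z' s - (z q - z s) ^ (α - 1) * z' s) := by
    rw [← intervalIntegral.integral_const_mul, ← Real.norm_eq_abs]
    refine intervalIntegral.norm_integral_le_of_norm_le hcp ?_ ((hint_p.sub hint_q).const_mul N)
    filter_upwards [MeasureTheory.Measure.ae_ne MeasureTheory.volume p] with s hsp hs
    have hs' : s ∈ Set.Icc c q := hsub (Set.Ioc_subset_Icc_self hs)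
    have hlt : z s < z p := hmono hs' ⟨hcp, hpq⟩ (lt_of_le_of_ne hs.2 hsp)
    have hle : z p ≤ z q := hmono.monotoneOn ⟨hcp, hpq⟩ ⟨hcp.trans hpq, le_rfl⟩ hpq
    have hkernel : 0 ≤ (z p - z s) ^ (α - 1) * z' s - (z q - z s) ^ (α - 1) * z' s :=
      sub_nonneg.2 (mul_le_mul_of_nonneg_right
        (Real.rpow_le_rpow_of_nonpos (by linarith) (by linarith) (by linarith)) (hpos s hs').le)
    rw [← sub_mul, Real.norm_eq_abs, abs_mul, abs_of_nonneg hkernel, mul_comm]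
    exact mul_le_mul_of_nonneg_right (hbound s hs') hkernel
  rw [intervalIntegral.integral_sub hint_p hint_q, heq_p, heq_q, hdiff, abs_sub_comm] at hhead
  simp only [sub_self, Real.zero_rpow hα₀.ne', sub_zero] at hhead htail
  have hcq : (z p - z c) ^ α ≤ (z q - z c) ^ α := by
    refine Real.rpow_le_rpow (sub_nonneg.2 ?_) (sub_le_sub_right ?_ _) hα₀.le
    · exact hmono.monotoneOn ⟨le_rfl, hcp.trans hpq⟩ ⟨hcp, hpq⟩ hcp
    · exact hmono.monotoneOn ⟨hcp, hpq⟩ ⟨hcp.trans hpq, le_rfl⟩ hpq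
  rw [← hsplit]
  calc _ ≤ _ := by rw [add_sub_right_comm]; exact abs_add_le _ _
    _ ≤ _ := add_le_add hhead htail
    _ = N * ((z p - z c) ^ α - (z q - z c) ^ α) / α + 2 * N * (z q - z p) ^ α / α := by ring
    _ ≤ _ := add_le_of_nonpos_left (div_nonpos_of_nonpos_of_nonneg
        (mul_nonpos_of_nonneg_of_nonpos hN (sub_nonpos.2 hcq)) hα₀.le)

/-- Step 3 of the proof of the paper's Theorem 3.6, case `𝕋 = ℝ`.
If `|f(t,u)| ≤ N` on `J × ℝ`, then the family `{F y : y ∈ C(J, ℝ)}` is equicontinuous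
on `J`: for every `ε > 0` there is `δ > 0` such that `|F y t₂ − F y t₁| < ε` whenever
`t₁, t₂ ∈ J`, `|t₂ − t₁| < δ`, and `y` is continuous on `J`. -/
theorem operator_family_equicontinuous
    (t₀ a α : ℝ) (ha : 0 < a) (hα₀ : 0 < α) (hα₁ : α < 1)
    (z z' : ℝ → ℝ)
    (hz_deriv : ∀ t ∈ Set.Icc t₀ (t₀ + a), HasDerivAt z (z' t) t)
    (hz'_cont : ContinuousOn z' (Set.Icc t₀ (t₀ + a)))
    (hz_mono : StrictMonoOn z (Set.Icc t₀ (t₀ + a)))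
    (hz'_pos : ∀ t ∈ Set.Icc t₀ (t₀ + a), 0 < z' t)
    (f : ℝ → ℝ → ℝ)
    (hf : ContinuousOn (fun p : ℝ × ℝ => f p.1 p.2) (Set.Icc t₀ (t₀ + a) ×ˢ Set.univ))
    (N : ℝ) (hN : 0 < N)
    (hbound : ∀ t ∈ Set.Icc t₀ (t₀ + a), ∀ u : ℝ, |f t u| ≤ N)
    (F : (ℝ → ℝ) → ℝ → ℝ)
    (hF : ∀ y : ℝ → ℝ, ∀ t : ℝ, F y t = z' t / Real.Gamma α *
      ∫ s in t₀..t, (z t - z s) ^ (α - 1) * z' s * f s (y s)) :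
    ∀ ε > (0 : ℝ), ∃ δ > (0 : ℝ),
      ∀ t₁ ∈ Set.Icc t₀ (t₀ + a), ∀ t₂ ∈ Set.Icc t₀ (t₀ + a),
        |t₂ - t₁| < δ →
        ∀ y : ℝ → ℝ, ContinuousOn y (Set.Icc t₀ (t₀ + a)) →
          |F y t₂ - F y t₁| < ε := by
  intro ε hε
  set J := Set.Icc t₀ (t₀ + a) with hJ
  have hΓ : 0 < Real.Gamma α := Real.Gamma_pos_of_pos hα₀
  have hz_cont : ContinuousOn z J := fun t ht =>
    (hz_deriv t ht).continuousAt.continuousWithinAt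
  -- A modulus of continuity common to all `F y`, vanishing on the diagonal.
  let G : ℝ × ℝ → ℝ := fun x =>
    |z' x.2 - z' x.1| / Real.Gamma α * (N * ((z x.2 - z t₀) ^ α / α)) +
      z' x.1 / Real.Gamma α * (2 * N * |z x.2 - z x.1| ^ α / α)
  have hG_cont : ContinuousOn G (J ×ˢ J) := by
    have h₁ : ContinuousOn (fun x : ℝ × ℝ => z x.1) (J ×ˢ J) :=
      hz_cont.comp continuousOn_fst fun x hx => hx.1
    have h₂ : ContinuousOn (fun x : ℝ × ℝ => z x.2) (J ×ˢ J) :=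
      hz_cont.comp continuousOn_snd fun x hx => hx.2
    have h₁' : ContinuousOn (fun x : ℝ × ℝ => z' x.1) (J ×ˢ J) :=
      hz'_cont.comp continuousOn_fst fun x hx => hx.1
    have h₂' : ContinuousOn (fun x : ℝ × ℝ => z' x.2) (J ×ˢ J) :=
      hz'_cont.comp continuousOn_snd fun x hx => hx.2
    have hpow₁ : ContinuousOn (fun x : ℝ × ℝ => (z x.2 - z t₀) ^ α) (J ×ˢ J) :=
      (h₂.sub continuousOn_const).rpow_const fun _ _ => Or.inr hα₀.le
    have hpow₂ : ContinuousOn (fun x : ℝ × ℝ => |z x.2 - z x.1| ^ α) (J ×ˢ J) :=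
      (h₂.sub h₁).abs.rpow_const fun _ _ => Or.inr hα₀.le
    exact (((h₂'.sub h₁').abs.div_const _).mul (continuousOn_const.mul (hpow₁.div_const _))).add
      ((h₁'.div_const _).mul ((continuousOn_const.mul hpow₂).div_const _))
  obtain ⟨δ, hδ, hGδ⟩ := Metric.uniformContinuousOn_iff.1
    ((isCompact_Icc.prod isCompact_Icc).uniformContinuousOn_of_continuous hG_cont) ε hε
  refine ⟨δ, hδ, fun t₁ ht₁ t₂ ht₂ hdist y hy => ?_⟩
  have hG_lt : G (t₁, t₂) < ε := by
    have hdiag : G (t₁, t₁) = 0 := by simp [G, Real.zero_rpow hα₀.ne']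
    have h := hGδ (t₁, t₂) ⟨ht₁, ht₂⟩ (t₁, t₁) ⟨ht₁, ht₁⟩
      (by simpa [Prod.dist_eq, Real.dist_eq, hδ] using hdist)
    rw [Real.dist_eq, hdiag, sub_zero] at h
    exact (le_abs_self _).trans_lt h
  refine lt_of_le_of_lt ?_ hG_lt
  have hg : ContinuousOn (fun s => f s (y s)) J :=
    hf.comp (continuousOn_id.prodMk hy) fun s hs => ⟨hs, trivial⟩
  have hsub : ∀ t ∈ J, Set.Icc t₀ t ⊆ J := fun t ht => Set.Icc_subset_Icc_right ht.2
  have hsize := abs_integral_rpow_sub_mul_le hα₀ ht₂.1 le_rfl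
    (fun s hs => hz_deriv s (hsub t₂ ht₂ hs)) (hz_mono.mono (hsub t₂ ht₂))
    (fun s hs => hz'_pos s (hsub t₂ ht₂ hs)) fun s hs => hbound s (hsub t₂ ht₂ hs) (y s)
  rw [sub_self, Real.zero_rpow hα₀.ne', sub_zero] at hsize
  have hincr_le : ∀ p ∈ J, ∀ q ∈ J, p ≤ q →
      |(∫ s in t₀..q, (z q - z s) ^ (α - 1) * z' s * f s (y s)) -
        ∫ s in t₀..p, (z p - z s) ^ (α - 1) * z' s * f s (y s)| ≤
      2 * N * |z q - z p| ^ α / α := fun p hp q hq hpq => by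
    rw [abs_of_nonneg (sub_nonneg.2 (hz_mono.monotoneOn hp hq hpq))]
    exact abs_integral_rpow_sub_mul_sub_le hα₀ hα₁ hp.1 hpq
      (fun s hs => hz_deriv s (hsub q hq hs)) (hz_mono.mono (hsub q hq))
      (fun s hs => hz'_pos s (hsub q hq hs)) (hg.mono (hsub q hq)) hN.le
      fun s hs => hbound s (hsub q hq hs) (y s)
  have hincr : |(∫ s in t₀..t₂, (z t₂ - z s) ^ (α - 1) * z' s * f s (y s)) -
        ∫ s in t₀..t₁, (z t₁ - z s) ^ (α - 1) * z' s * f s (y s)| ≤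
      2 * N * |z t₂ - z t₁| ^ α / α := by
    rcases le_total t₁ t₂ with h | h
    · exact hincr_le t₁ ht₁ t₂ ht₂ h
    · rw [abs_sub_comm, abs_sub_comm (z t₂)]
      exact hincr_le t₂ ht₂ t₁ ht₁ h
  rw [hF, hF]
  set I₁ := ∫ s in t₀..t₁, (z t₁ - z s) ^ (α - 1) * z' s * f s (y s)
  set I₂ := ∫ s in t₀..t₂, (z t₂ - z s) ^ (α - 1) * z' s * f s (y s)
  have hz'₁ : 0 ≤ z' t₁ / Real.Gamma α := div_nonneg (hz'_pos t₁ ht₁).le hΓ.le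
  calc |z' t₂ / Real.Gamma α * I₂ - z' t₁ / Real.Gamma α * I₁|
      = |(z' t₂ - z' t₁) / Real.Gamma α * I₂ + z' t₁ / Real.Gamma α * (I₂ - I₁)| := by
        congr 1; ring
    _ ≤ |(z' t₂ - z' t₁) / Real.Gamma α * I₂| + |z' t₁ / Real.Gamma α * (I₂ - I₁)| :=
        abs_add_le _ _
    _ = |z' t₂ - z' t₁| / Real.Gamma α * |I₂| + z' t₁ / Real.Gamma α * |I₂ - I₁| := by
        rw [abs_mul, abs_mul, abs_div, abs_of_pos hΓ, abs_of_nonneg hz'₁]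
    _ ≤ G (t₁, t₂) := add_le_add
        (mul_le_mul_of_nonneg_left hsize (div_nonneg (abs_nonneg _) hΓ.le))
        (mul_le_mul_of_nonneg_left hincr hz'₁)
end

section
/- Let t₀ ∈ ℝ, a > 0, J = [t₀, t₀ + a], and let 0 < α < 1. Let z : ℝ → ℝ be continuously differentiable and strictly increasing on J with z'(t) > 0 for all t ∈ J. Let f : J × ℝ → ℝ be continuous and suppose there exists N > 0 such that |f(t,u)| ≤ N for all t ∈ J and u ∈ ℝ. Then the operator F : C(J, ℝ) → C(J, ℝ) defined by F(y)(t) = (z'(t)/Γ(α)) ∫_{t₀}^{t} (z(t) − z(s))^{α−1} z'(s) f(s, y(s)) ds is completely continuous: F is continuous and the image under F of any bounded subset of C(J, ℝ) is relatively compact in C(J, ℝ) (with the supremum norm). -/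
open Set Filter Topology MeasureTheory

/-- The substitution `v = z s` in the Abel kernel: the weighted kernel is integrable, with an
explicit integral. -/
theorem abelKernel_intervalIntegrable_and_integral {α u t : ℝ} {z z' : ℝ → ℝ} (hα : 0 < α)
    (hut : u ≤ t) (hz : ∀ s ∈ Icc u t, HasDerivAt z (z' s) s) (hmono : StrictMonoOn z (Icc u t))
    (hpos : ∀ s ∈ Icc u t, 0 < z' s) :
    IntervalIntegrable (fun s => (z t - z s) ^ (α - 1) * z' s) volume u t ∧
      ∫ s in u..t, (z t - z s) ^ (α - 1) * z' s = (z t - z u) ^ α / α := by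
  have hcont : ContinuousOn (fun s => -((z t - z s) ^ α / α)) (Icc u t) := by
    have hzc : ContinuousOn z (Icc u t) := fun s hs => (hz s hs).continuousAt.continuousWithinAt
    exact (((continuousOn_const.sub hzc).rpow_const fun s _ => Or.inr hα.le).div_const α).neg
  have hderiv : ∀ s ∈ Ioo u t, HasDerivAt (fun s => -((z t - z s) ^ α / α))
      ((z t - z s) ^ (α - 1) * z' s) s := by
    intro s hs
    have hlt : 0 < z t - z s :=
      sub_pos.2 (hmono (Ioo_subset_Icc_self hs) (right_mem_Icc.2 hut) hs.2)
    have h := ((((hz s (Ioo_subset_Icc_self hs)).const_sub (z t)).rpow_const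
      (p := α) (Or.inl hlt.ne')).div_const α).neg
    refine h.congr_deriv ?_
    field_simp
  have hnonneg : ∀ s ∈ Ioo u t, 0 ≤ (z t - z s) ^ (α - 1) * z' s := by
    intro s hs
    have hlt : 0 < z t - z s :=
      sub_pos.2 (hmono (Ioo_subset_Icc_self hs) (right_mem_Icc.2 hut) hs.2)
    exact mul_nonneg (Real.rpow_nonneg hlt.le _) (hpos s (Ioo_subset_Icc_self hs)).le
  have hint : IntervalIntegrable (fun s => (z t - z s) ^ (α - 1) * z' s) volume u t :=
    (intervalIntegrable_iff_integrableOn_Ioc_of_le hut).2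
      (intervalIntegral.integrableOn_deriv_of_nonneg hcont hderiv hnonneg)
  refine ⟨hint, ?_⟩
  rw [intervalIntegral.integral_eq_sub_of_hasDerivAt_of_le hut hcont hderiv hint]
  simp [Real.zero_rpow hα.ne']

/-- A fractional integral with respect to `z` of a function bounded by `N` is bounded by the
fractional integral of the constant `N`. -/
theorem abs_abelIntegral_le {α u t N : ℝ} {z z' h : ℝ → ℝ} (hα : 0 < α)
    (hut : u ≤ t) (hz : ∀ s ∈ Icc u t, HasDerivAt z (z' s) s) (hmono : StrictMonoOn z (Icc u t))
    (hpos : ∀ s ∈ Icc u t, 0 < z' s) (hN : ∀ s ∈ Icc u t, |h s| ≤ N) :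
    |∫ s in u..t, (z t - z s) ^ (α - 1) * z' s * h s| ≤ N * ((z t - z u) ^ α / α) := by
  obtain ⟨hint, heq⟩ := abelKernel_intervalIntegrable_and_integral hα hut hz hmono hpos
  rw [← heq, ← intervalIntegral.integral_const_mul, ← Real.norm_eq_abs]
  refine intervalIntegral.norm_integral_le_of_norm_le hut (ae_of_all _ fun s hs => ?_)
    (hint.const_mul N)
  have hs' := Ioc_subset_Icc_self hs
  have hle : 0 ≤ z t - z s := sub_nonneg.2 (hmono.monotoneOn hs' (right_mem_Icc.2 hut) hs.2)
  have hk : 0 ≤ (z t - z s) ^ (α - 1) * z' s := mul_nonneg (Real.rpow_nonneg hle _) (hpos s hs').le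
  rw [Real.norm_eq_abs, abs_mul, abs_of_nonneg hk, mul_comm N]
  exact mul_le_mul_of_nonneg_left (hN s hs') hk

/-- The fractional integral with respect to `z` of a continuous function bounded by `N` is
Hölder continuous with respect to `z`. -/
theorem abs_abelIntegral_sub_le {α b u t N : ℝ} {z z' h : ℝ → ℝ} (hα₀ : 0 < α) (hα₁ : α < 1)
    (hbu : b ≤ u) (hut : u ≤ t) (hz : ∀ s ∈ Icc b t, HasDerivAt z (z' s) s)
    (hmono : StrictMonoOn z (Icc b t)) (hpos : ∀ s ∈ Icc b t, 0 < z' s)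
    (hh : ContinuousOn h (Icc b t)) (hN : ∀ s ∈ Icc b t, |h s| ≤ N) :
    |(∫ s in b..t, (z t - z s) ^ (α - 1) * z' s * h s) -
        ∫ s in b..u, (z u - z s) ^ (α - 1) * z' s * h s| ≤
      2 * N / α * (z t - z u) ^ α := by
  have hbt := hbu.trans hut
  have hN₀ : 0 ≤ N := (abs_nonneg _).trans (hN b (left_mem_Icc.2 hbt))
  have hsub₁ : Icc b u ⊆ Icc b t := Icc_subset_Icc_right hut
  have hsub₂ : Icc u t ⊆ Icc b t := Icc_subset_Icc_left hbu
  obtain ⟨hi, he⟩ := abelKernel_intervalIntegrable_and_integral hα₀ hbt hz hmono hpos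
  obtain ⟨hi₁, he₁⟩ := abelKernel_intervalIntegrable_and_integral hα₀ hbu
    (fun s hs => hz s (hsub₁ hs)) (hmono.mono hsub₁) (fun s hs => hpos s (hsub₁ hs))
  obtain ⟨hi₂, he₂⟩ := abelKernel_intervalIntegrable_and_integral hα₀ hut
    (fun s hs => hz s (hsub₂ hs)) (hmono.mono hsub₂) (fun s hs => hpos s (hsub₂ hs))
  have hi₃ : IntervalIntegrable (fun s => (z t - z s) ^ (α - 1) * z' s) volume b u :=
    hi.mono_set (by rw [uIcc_of_le hbu, uIcc_of_le hbt]; exact hsub₁)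
  have he₃ := intervalIntegral.integral_add_adjacent_intervals hi₃ hi₂
  have hh₁ : ContinuousOn h (uIcc b u) := by rw [uIcc_of_le hbu]; exact hh.mono hsub₁
  have hh₂ : ContinuousOn h (uIcc u t) := by rw [uIcc_of_le hut]; exact hh.mono hsub₂
  have hnear := abs_abelIntegral_le hα₀ hut (fun s hs => hz s (hsub₂ hs)) (hmono.mono hsub₂)
    (fun s hs => hpos s (hsub₂ hs)) (fun s hs => hN s (hsub₂ hs))
  have hfar : |∫ s in b..u, ((z t - z s) ^ (α - 1) * z' s * h s -
        (z u - z s) ^ (α - 1) * z' s * h s)| ≤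
      ∫ s in b..u, N * ((z u - z s) ^ (α - 1) * z' s - (z t - z s) ^ (α - 1) * z' s) := by
    rw [← Real.norm_eq_abs]
    refine intervalIntegral.norm_integral_le_of_norm_le hbu ?_ ((hi₁.sub hi₃).const_mul N)
    filter_upwards [compl_mem_ae_iff.2 (measure_singleton u)] with s hsu hs
    have hs' : s ∈ Icc b t := hsub₁ (Ioc_subset_Icc_self hs)
    have hu' : u ∈ Icc b t := ⟨hbu, hut⟩
    have hsu' : 0 < z u - z s := sub_pos.2 (hmono hs' hu' (lt_of_le_of_ne hs.2 hsu))
    have hle : z u - z s ≤ z t - z s :=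
      sub_le_sub_right (hmono.monotoneOn hu' (right_mem_Icc.2 hbt) hut) _
    have hk : 0 ≤ (z u - z s) ^ (α - 1) * z' s - (z t - z s) ^ (α - 1) * z' s :=
      sub_nonneg.2 (mul_le_mul_of_nonneg_right
        (Real.rpow_le_rpow_of_nonpos hsu' hle (by linarith)) (hpos s hs').le)
    rw [Real.norm_eq_abs, ← sub_mul, abs_mul, abs_sub_comm, abs_of_nonneg hk, mul_comm N]
    exact mul_le_mul_of_nonneg_left (hN s hs') hk
  rw [intervalIntegral.integral_const_mul, intervalIntegral.integral_sub hi₁ hi₃, he₁,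
    eq_sub_of_add_eq he₃, he, he₂] at hfar
  rw [intervalIntegral.integral_sub (hi₃.mul_continuousOn hh₁) (hi₁.mul_continuousOn hh₁)] at hfar
  rw [← intervalIntegral.integral_add_adjacent_intervals (hi₃.mul_continuousOn hh₁)
    (hi₂.mul_continuousOn hh₂), add_sub_right_comm]
  have hmon : (z u - z b) ^ α ≤ (z t - z b) ^ α :=
    Real.rpow_le_rpow
      (sub_nonneg.2 (hmono.monotoneOn (left_mem_Icc.2 hbt) ⟨hbu, hut⟩ hbu))
      (sub_le_sub_right (hmono.monotoneOn ⟨hbu, hut⟩ (right_mem_Icc.2 hbt) hut) _) hα₀.le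
  have hmon' : (z u - z b) ^ α / α ≤ (z t - z b) ^ α / α :=
    div_le_div_of_nonneg_right hmon hα₀.le
  have hNmon := mul_le_mul_of_nonneg_left hmon' hN₀
  have hrw : 2 * N / α * (z t - z u) ^ α = 2 * (N * ((z t - z u) ^ α / α)) := by ring
  rw [hrw]
  refine (abs_add_le _ _).trans ?_
  nlinarith

/-- Sequential Arzelà–Ascoli for real functions on a compact set. -/
theorem exists_subseq_tendstoUniformlyOn_of_equicontinuousOn {X : Type*} [TopologicalSpace X]
    {K : Set X} (hK : IsCompact K) {G : ℕ → X → ℝ} {B : ℝ}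
    (hB : ∀ n, ∀ x ∈ K, |G n x| ≤ B) (hG : EquicontinuousOn G K) :
    ∃ (φ : ℕ → ℕ) (g : X → ℝ), StrictMono φ ∧ ContinuousOn g K ∧
      TendstoUniformlyOn (fun k => G (φ k)) g atTop K := by
  classical
  have : CompactSpace K := isCompact_iff_compactSpace.1 hK
  have hE : Equicontinuous (K.domRestrict ∘ G) := equicontinuous_restrict_iff G |>.2 hG
  let T : ℕ → BoundedContinuousFunction K ℝ := fun n =>
    BoundedContinuousFunction.mkOfCompact ⟨K.domRestrict (G n), hE.continuous n⟩
  have hcomp : IsCompact (closure (range T)) := by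
    refine BoundedContinuousFunction.arzela_ascoli (Icc (-B) B) isCompact_Icc _ ?_ ?_
    · rintro _ x ⟨n, rfl⟩
      exact abs_le.1 (hB n x x.2)
    · intro x U hU
      filter_upwards [hE x U hU] with y hy
      rintro ⟨_, n, rfl⟩
      exact hy n
  obtain ⟨g, -, φ, hφ, hlim⟩ := hcomp.tendsto_subseq fun n => subset_closure (mem_range_self n)
  have hext : K.domRestrict (fun x => if hx : x ∈ K then g ⟨x, hx⟩ else 0) = g := by
    ext x; simp
  refine ⟨φ, fun x => if hx : x ∈ K then g ⟨x, hx⟩ else 0, hφ, ?_, ?_⟩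
  · rw [continuousOn_iff_continuous_domRestrict, hext]
    exact g.continuous
  · rw [tendstoUniformlyOn_iff_restrict, hext]
    exact BoundedContinuousFunction.tendsto_iff_tendstoUniformly.1 hlim

theorem TendstoUniformlyOn.const_mul_of_abs_le {ι X : Type*} {l : Filter ι} {K : Set X}
    {G : ι → X → ℝ} {g c : X → ℝ} {M : ℝ} (h : TendstoUniformlyOn G g l K)
    (hc : ∀ x ∈ K, |c x| ≤ M) :
    TendstoUniformlyOn (fun i x => c x * G i x) (fun x => c x * g x) l K := by
  rw [Metric.tendstoUniformlyOn_iff] at h ⊢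
  intro ε hε
  have hM : 0 < |M| + 1 := by positivity
  filter_upwards [h (ε / (|M| + 1)) (by positivity)] with i hi x hx
  have h₁ := hi x hx
  rw [Real.dist_eq] at h₁ ⊢
  rw [← mul_sub, abs_mul]
  calc |c x| * |g x - G i x| ≤ (|M| + 1) * |g x - G i x| := by
        gcongr
        linarith [hc x hx, le_abs_self M]
    _ < (|M| + 1) * (ε / (|M| + 1)) := by gcongr
    _ = ε := by field_simp

/-- The Nemytskii (superposition) operator of a continuous function preserves uniform convergence
to a continuous limit on a compact set. -/
theorem tendstoUniformlyOn_superposition {ι : Type*} {l : Filter ι} {K : Set ℝ}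
    (hK : IsCompact K) {f : ℝ → ℝ → ℝ}
    (hf : ContinuousOn (fun p : ℝ × ℝ => f p.1 p.2) (K ×ˢ univ))
    {Y : ι → ℝ → ℝ} {y : ℝ → ℝ} (hy : ContinuousOn y K) (hY : TendstoUniformlyOn Y y l K) :
    TendstoUniformlyOn (fun i s => f s (Y i s)) (fun s => f s (y s)) l K := by
  obtain ⟨M, hM⟩ := hK.exists_bound_of_continuousOn hy
  have hcomp : IsCompact (K ×ˢ Icc (-(M + 1)) (M + 1)) := hK.prod isCompact_Icc
  have huc := hcomp.uniformContinuousOn_of_continuous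
    (hf.mono (prod_mono Subset.rfl (subset_univ _)))
  rw [Metric.uniformContinuousOn_iff] at huc
  rw [Metric.tendstoUniformlyOn_iff] at hY ⊢
  intro ε hε
  obtain ⟨δ, hδ, H⟩ := huc ε hε
  filter_upwards [hY (min δ 1) (by positivity)] with i hi s hs
  have h₁ := hi s hs
  have h₂ := hM s hs
  have h₃ := h₁.trans_le (min_le_right _ _)
  rw [Real.dist_eq, abs_lt] at h₃
  rw [Real.norm_eq_abs, abs_le] at h₂
  refine H (s, y s) ⟨hs, by constructor <;> linarith⟩ (s, Y i s)
    ⟨hs, by constructor <;> linarith⟩ ?_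
  rw [Prod.dist_eq, dist_self]
  exact max_lt hδ (h₁.trans_le (min_le_left _ _))

/-- conclusion of Steps 1–3 of the proof of the paper's Theorem 3.6,
case `𝕋 = ℝ`, via Arzelà–Ascoli. If `|f(t,u)| ≤ N` on `J × ℝ`, the operator
`F(y)(t) = (z' t / Γ α) ∫_{t₀}^{t} (z t − z s)^(α−1) z' s · f s (y s) ds` is
completely continuous on `C(J, ℝ)`: it maps continuous functions to continuous
functions, is continuous with respect to uniform convergence on `J`, and sends every
(uniformly) bounded set of continuous functions into a relatively compact set, i.e.
every sequence in the image of a bounded set has a subsequence converging uniformly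
on `J` to a continuous function. -/
theorem operator_completely_continuous
    (t₀ a α : ℝ) (ha : 0 < a) (hα₀ : 0 < α) (hα₁ : α < 1)
    (z z' : ℝ → ℝ)
    (hz_deriv : ∀ t ∈ Set.Icc t₀ (t₀ + a), HasDerivAt z (z' t) t)
    (hz'_cont : ContinuousOn z' (Set.Icc t₀ (t₀ + a)))
    (hz_mono : StrictMonoOn z (Set.Icc t₀ (t₀ + a)))
    (hz'_pos : ∀ t ∈ Set.Icc t₀ (t₀ + a), 0 < z' t)
    (f : ℝ → ℝ → ℝ)
    (hf : ContinuousOn (fun p : ℝ × ℝ => f p.1 p.2) (Set.Icc t₀ (t₀ + a) ×ˢ Set.univ))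
    (N : ℝ) (hN : 0 < N)
    (hbound : ∀ t ∈ Set.Icc t₀ (t₀ + a), ∀ u : ℝ, |f t u| ≤ N)
    (F : (ℝ → ℝ) → ℝ → ℝ)
    (hF : ∀ y : ℝ → ℝ, ∀ t : ℝ, F y t = z' t / Real.Gamma α *
      ∫ s in t₀..t, (z t - z s) ^ (α - 1) * z' s * f s (y s)) :
    (∀ y : ℝ → ℝ, ContinuousOn y (Set.Icc t₀ (t₀ + a)) →
      ContinuousOn (F y) (Set.Icc t₀ (t₀ + a))) ∧
    (∀ (Y : ℕ → ℝ → ℝ) (y : ℝ → ℝ),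
      (∀ n, ContinuousOn (Y n) (Set.Icc t₀ (t₀ + a))) →
      ContinuousOn y (Set.Icc t₀ (t₀ + a)) →
      TendstoUniformlyOn Y y Filter.atTop (Set.Icc t₀ (t₀ + a)) →
      TendstoUniformlyOn (fun n => F (Y n)) (F y) Filter.atTop
        (Set.Icc t₀ (t₀ + a))) ∧
    (∀ (C : ℝ) (Y : ℕ → ℝ → ℝ),
      (∀ n, ContinuousOn (Y n) (Set.Icc t₀ (t₀ + a))) →
      (∀ n, ∀ t ∈ Set.Icc t₀ (t₀ + a), |Y n t| ≤ C) →
      ∃ (φ : ℕ → ℕ) (g : ℝ → ℝ), StrictMono φ ∧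
        ContinuousOn g (Set.Icc t₀ (t₀ + a)) ∧
        TendstoUniformlyOn (fun k => F (Y (φ k))) g Filter.atTop
          (Set.Icc t₀ (t₀ + a))) := by
  set J := Icc t₀ (t₀ + a)
  have hJc : IsCompact J := isCompact_Icc
  have ht₀ : t₀ ∈ J := ⟨le_rfl, by linarith⟩
  have hzc : ContinuousOn z J := fun s hs => (hz_deriv s hs).continuousAt.continuousWithinAt
  set A : (ℝ → ℝ) → ℝ → ℝ := fun h t => ∫ s in t₀..t, (z t - z s) ^ (α - 1) * z' s * h s with hA
  have hF' : ∀ y, F y = fun t => z' t / Real.Gamma α * A (fun s => f s (y s)) t :=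
    fun y => funext (hF y)
  have hcomp : ∀ y, ContinuousOn y J → ContinuousOn (fun s => f s (y s)) J := fun y hy =>
    hf.comp (continuousOn_id.prodMk hy) fun s hs => ⟨hs, mem_univ _⟩
  have hccont : ContinuousOn (fun t => z' t / Real.Gamma α) J := hz'_cont.div_const _
  obtain ⟨M, hM⟩ := hJc.exists_bound_of_continuousOn hccont
  have hsub : ∀ t ∈ J, Icc t₀ t ⊆ J := fun t ht => Icc_subset_Icc_right ht.2
  have hHolder : ∀ y, ContinuousOn y J → ∀ u ∈ J, ∀ t ∈ J,
      |A (fun s => f s (y s)) u - A (fun s => f s (y s)) t| ≤ 2 * N / α * |z t - z u| ^ α := by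
    intro y hy u hu t ht
    wlog hut : u ≤ t generalizing u t
    · rw [abs_sub_comm, abs_sub_comm (z t)]
      exact this t ht u hu (le_of_not_ge hut)
    rw [abs_sub_comm, abs_of_nonneg (sub_nonneg.2 (hz_mono.monotoneOn hu ht hut))]
    exact abs_abelIntegral_sub_le hα₀ hα₁ hu.1 hut (fun s hs => hz_deriv s (hsub t ht hs))
      (hz_mono.mono (hsub t ht)) (fun s hs => hz'_pos s (hsub t ht hs))
      ((hcomp y hy).mono (hsub t ht)) (fun s hs => hbound s (hsub t ht hs) _)
  have hequi : ∀ Y : ℕ → ℝ → ℝ, (∀ n, ContinuousOn (Y n) J) →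
      EquicontinuousOn (fun n => A (fun s => f s (Y n s))) J := by
    intro Y hY
    rw [← equicontinuous_restrict_iff]
    intro u
    refine Metric.equicontinuousAt_of_continuity_modulus
      (fun t : J => 2 * N / α * |z t - z u| ^ α) ?_ _
      (Eventually.of_forall fun t n => hHolder (Y n) (hY n) u u.2 t t.2)
    have hcont : Continuous fun t : J => 2 * N / α * |z t - z u| ^ α :=
      (((hzc.domRestrict.sub continuous_const).abs).rpow_const fun _ => Or.inr hα₀.le).const_mul _
    simpa [Real.zero_rpow hα₀.ne'] using hcont.tendsto u
  have hzle : ∀ t ∈ J, (z t - z t₀) ^ α ≤ (z (t₀ + a) - z t₀) ^ α := fun t ht =>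
    Real.rpow_le_rpow (sub_nonneg.2 (hz_mono.monotoneOn ht₀ ht ht.1))
      (sub_le_sub_right (hz_mono.monotoneOn ht (right_mem_Icc.2 (by linarith)) ht.2) _) hα₀.le
  have hAle : ∀ (h : ℝ → ℝ) (D : ℝ), 0 ≤ D → (∀ s ∈ J, |h s| ≤ D) → ∀ t ∈ J,
      |A h t| ≤ D * ((z (t₀ + a) - z t₀) ^ α / α) := by
    intro h D hD hh t ht
    refine (abs_abelIntegral_le hα₀ ht.1 (fun s hs => hz_deriv s (hsub t ht hs))
      (hz_mono.mono (hsub t ht)) (fun s hs => hz'_pos s (hsub t ht hs))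
      (fun s hs => hh s (hsub t ht hs))).trans ?_
    exact mul_le_mul_of_nonneg_left (div_le_div_of_nonneg_right (hzle t ht) hα₀.le) hD
  refine ⟨fun y hy => ?_, fun Y y hY hy hlim => ?_, fun C Y hY _ => ?_⟩
  · rw [hF']
    exact hccont.mul ((hequi (fun _ => y) fun _ => hy).continuousOn 0)
  · simp only [hF']
    refine TendstoUniformlyOn.const_mul_of_abs_le ?_ hM
    have hnem := tendstoUniformlyOn_superposition hJc hf hy hlim
    rw [Metric.tendstoUniformlyOn_iff] at hnem ⊢
    intro ε hε
    set R := (z (t₀ + a) - z t₀) ^ α / α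
    have hR₀ : 0 ≤ R := div_nonneg (Real.rpow_nonneg (sub_nonneg.2
      (hz_mono.monotoneOn ht₀ (right_mem_Icc.2 (by linarith)) (by linarith))) _) hα₀.le
    filter_upwards [hnem (ε / (R + 1)) (by positivity)] with n hn t ht
    have hint : ∀ w, ContinuousOn w J → IntervalIntegrable
        (fun s => (z t - z s) ^ (α - 1) * z' s * f s (w s)) volume t₀ t := by
      intro w hw
      refine (abelKernel_intervalIntegrable_and_integral hα₀ ht.1
        (fun s hs => hz_deriv s (hsub t ht hs)) (hz_mono.mono (hsub t ht))
        (fun s hs => hz'_pos s (hsub t ht hs))).1.mul_continuousOn ?_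
      rw [uIcc_of_le ht.1]
      exact (hcomp w hw).mono (hsub t ht)
    have hdiff : A (fun s => f s (y s)) t - A (fun s => f s (Y n s)) t =
        A (fun s => f s (y s) - f s (Y n s)) t := by
      simp only [hA, mul_sub]
      exact (intervalIntegral.integral_sub (hint y hy) (hint (Y n) (hY n))).symm
    rw [Real.dist_eq, hdiff]
    refine (hAle _ (ε / (R + 1)) (by positivity) (fun s hs => (hn s hs).le) t ht).trans_lt ?_
    rw [div_mul_eq_mul_div, div_lt_iff₀ (by positivity)]
    nlinarith
  · obtain ⟨φ, g, hφ, hg, hlim⟩ := exists_subseq_tendstoUniformlyOn_of_equicontinuousOn hJc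
      (fun n => hAle _ N hN.le fun s hs => hbound s hs (Y n s)) (hequi Y hY)
    refine ⟨φ, fun t => z' t / Real.Gamma α * g t, hφ, hccont.mul hg, ?_⟩
    simp only [hF']
    exact hlim.const_mul_of_abs_le hM
end

section
/- Let t₀ ∈ ℝ, a > 0, J = [t₀, t₀ + a], and let 0 < α < 1. Let z : ℝ → ℝ be continuously differentiable and strictly increasing on J with z'(t) > 0 for all t ∈ J. Let f : J × ℝ → ℝ be continuous and suppose there exists N > 0 such that |f(t,u)| ≤ N for all t ∈ J and u ∈ ℝ. Then the set E = { y ∈ C(J, ℝ) : there exists λ ∈ (0,1) with y = λ·F(y) } is bounded: every y ∈ E satisfies |y(t)| ≤ z'(t) N M_α(t) (t − t₀) / Γ(α) for all t ∈ J, hence ‖y‖_∞ ≤ sup_{t ∈ J} z'(t) N M_α(t)(t − t₀)/Γ(α). -/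
/-- The fractional kernel `(z t - z s) ^ (α - 1) * z' s` is integrable on `[t₀, t]`, with
integral `(z t - z t₀) ^ α / α`. -/
theorem fractional_kernel_integral {t₀ t α : ℝ} (ht : t₀ ≤ t) (hα : 0 < α) {z z' : ℝ → ℝ}
    (hz_cont : ContinuousOn z (Set.Icc t₀ t))
    (hz_deriv : ∀ s ∈ Set.Ioo t₀ t, HasDerivAt z (z' s) s)
    (hz_mono : StrictMonoOn z (Set.Icc t₀ t))
    (hz'_nonneg : ∀ s ∈ Set.Ioo t₀ t, 0 ≤ z' s) :
    IntervalIntegrable (fun s => (z t - z s) ^ (α - 1) * z' s) MeasureTheory.volume t₀ t ∧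
      ∫ s in t₀..t, (z t - z s) ^ (α - 1) * z' s = (z t - z t₀) ^ α / α := by
  have hpos : ∀ s ∈ Set.Ioo t₀ t, 0 < z t - z s := fun s hs =>
    sub_pos.2 (hz_mono ⟨hs.1.le, hs.2.le⟩ ⟨ht, le_rfl⟩ hs.2)
  have hcont : ContinuousOn (fun s => -((z t - z s) ^ α / α)) (Set.Icc t₀ t) :=
    (((continuousOn_const.sub hz_cont).rpow_const fun _ _ => Or.inr hα.le).div_const α).neg
  have hderiv : ∀ s ∈ Set.Ioo t₀ t,
      HasDerivAt (fun s => -((z t - z s) ^ α / α)) ((z t - z s) ^ (α - 1) * z' s) s := by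
    intro s hs
    refine ((((hz_deriv s hs).const_sub (z t)).rpow_const (p := α)
      (Or.inl (hpos s hs).ne')).div_const α).neg.congr_deriv ?_
    field_simp
  have hint : IntervalIntegrable (fun s => (z t - z s) ^ (α - 1) * z' s)
      MeasureTheory.volume t₀ t := by
    rw [intervalIntegrable_iff_integrableOn_Ioc_of_le ht]
    exact intervalIntegral.integrableOn_deriv_of_nonneg hcont hderiv fun s hs =>
      mul_nonneg (Real.rpow_nonneg (hpos s hs).le _) (hz'_nonneg s hs)
  refine ⟨hint, ?_⟩
  rw [intervalIntegral.integral_eq_sub_of_hasDerivAt_of_le ht hcont hderiv hint]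
  simp [Real.zero_rpow hα.ne']


/-- Step 4 of the proof of the paper's Theorem 3.6, case `𝕋 = ℝ`:
a priori boundedness. If `|f(t,u)| ≤ N` on `J × ℝ`, then every continuous `y` with
`y = λ F(y)` for some `λ ∈ (0,1)` satisfies
`|y t| ≤ z'(t) N M_α(t) (t − t₀)/Γ α` on `J`, hence
`‖y‖_∞ ≤ sup_{t ∈ J} z'(t) N M_α(t)(t − t₀)/Γ α`. -/
theorem a_priori_boundedness
    (t₀ a α : ℝ) (ha : 0 < a) (hα₀ : 0 < α) (hα₁ : α < 1)
    (z z' : ℝ → ℝ)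
    (hz_deriv : ∀ t ∈ Set.Icc t₀ (t₀ + a), HasDerivAt z (z' t) t)
    (hz'_cont : ContinuousOn z' (Set.Icc t₀ (t₀ + a)))
    (hz_mono : StrictMonoOn z (Set.Icc t₀ (t₀ + a)))
    (hz'_pos : ∀ t ∈ Set.Icc t₀ (t₀ + a), 0 < z' t)
    (f : ℝ → ℝ → ℝ)
    (hf : ContinuousOn (fun p : ℝ × ℝ => f p.1 p.2) (Set.Icc t₀ (t₀ + a) ×ˢ Set.univ))
    (N : ℝ) (hN : 0 < N)
    (hbound : ∀ t ∈ Set.Icc t₀ (t₀ + a), ∀ u : ℝ, |f t u| ≤ N)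
    (F : (ℝ → ℝ) → ℝ → ℝ)
    (hF : ∀ y : ℝ → ℝ, ∀ t : ℝ, F y t = z' t / Real.Gamma α *
      ∫ s in t₀..t, (z t - z s) ^ (α - 1) * z' s * f s (y s))
    (Mα : ℝ → ℝ)
    (hMα : ∀ t : ℝ, Mα t =
      (∫ s in t₀..t, (z t - z s) ^ (α - 1) * z' s) / (t - t₀)) :
    ∀ y : ℝ → ℝ, ContinuousOn y (Set.Icc t₀ (t₀ + a)) →
      ∀ lam : ℝ, lam ∈ Set.Ioo (0 : ℝ) 1 →
        (∀ t ∈ Set.Icc t₀ (t₀ + a), y t = lam * F y t) →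
        (∀ t ∈ Set.Icc t₀ (t₀ + a),
          |y t| ≤ z' t * N * Mα t * (t - t₀) / Real.Gamma α) ∧
        (⨆ t : Set.Icc t₀ (t₀ + a), |y t|) ≤
          ⨆ t : Set.Icc t₀ (t₀ + a),
            z' t * N * Mα t * ((t : ℝ) - t₀) / Real.Gamma α := by
  intro y _ lam hlam hy
  have hΓ : 0 < Real.Gamma α := Real.Gamma_pos_of_pos hα₀
  have hz_cont : ContinuousOn z (Set.Icc t₀ (t₀ + a)) := fun t ht =>
    (hz_deriv t ht).continuousAt.continuousWithinAt
  have hsub : ∀ t ∈ Set.Icc t₀ (t₀ + a), Set.Icc t₀ t ⊆ Set.Icc t₀ (t₀ + a) :=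
    fun t ht => Set.Icc_subset_Icc_right ht.2
  have hkernel := fun t (ht : t ∈ Set.Icc t₀ (t₀ + a)) =>
    fractional_kernel_integral (z' := z') ht.1 hα₀ (hz_cont.mono (hsub t ht))
      (fun s hs => hz_deriv s (hsub t ht (Set.Ioo_subset_Icc_self hs)))
      (hz_mono.mono (hsub t ht))
      (fun s hs => (hz'_pos s (hsub t ht (Set.Ioo_subset_Icc_self hs))).le)
  have hM : ∀ t, Mα t * (t - t₀) = ∫ s in t₀..t, (z t - z s) ^ (α - 1) * z' s := by
    intro t
    rw [hMα]
    rcases eq_or_ne t t₀ with rfl | h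
    · simp
    · exact div_mul_cancel₀ _ (sub_ne_zero.2 h)
  have hbd : ∀ t ∈ Set.Icc t₀ (t₀ + a),
      |y t| ≤ z' t * N * Mα t * (t - t₀) / Real.Gamma α := by
    intro t ht
    have hI : |∫ s in t₀..t, (z t - z s) ^ (α - 1) * z' s * f s (y s)| ≤
        (∫ s in t₀..t, (z t - z s) ^ (α - 1) * z' s) * N := by
      rw [← intervalIntegral.integral_mul_const, ← Real.norm_eq_abs]
      refine intervalIntegral.norm_integral_le_of_norm_le ht.1
        (Filter.Eventually.of_forall fun s hs => ?_) ((hkernel t ht).1.mul_const N)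
      have hs' := hsub t ht (Set.Ioc_subset_Icc_self hs)
      have hk : 0 ≤ (z t - z s) ^ (α - 1) * z' s :=
        mul_nonneg (Real.rpow_nonneg (sub_nonneg.2 (hz_mono.monotoneOn hs' ht hs.2)) _)
          (hz'_pos s hs').le
      rw [Real.norm_eq_abs, abs_mul, abs_of_nonneg hk]
      exact mul_le_mul_of_nonneg_left (hbound s hs' _) hk
    have hc : 0 ≤ z' t / Real.Gamma α := div_nonneg (hz'_pos t ht).le hΓ.le
    calc |y t| = lam * |F y t| := by rw [hy t ht, abs_mul, abs_of_pos hlam.1]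
      _ ≤ |F y t| := mul_le_of_le_one_left (abs_nonneg _) hlam.2.le
      _ ≤ z' t / Real.Gamma α * ((Mα t * (t - t₀)) * N) := by
        rw [hF, abs_mul, abs_of_nonneg hc, hM]
        exact mul_le_mul_of_nonneg_left hI hc
      _ = z' t * N * Mα t * (t - t₀) / Real.Gamma α := by ring
  refine ⟨hbd, ?_⟩
  have hcont : ContinuousOn (fun t => z' t * N * Mα t * (t - t₀) / Real.Gamma α)
      (Set.Icc t₀ (t₀ + a)) := by
    have h : ContinuousOn (fun t => z' t * N * ((z t - z t₀) ^ α / α) / Real.Gamma α)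
        (Set.Icc t₀ (t₀ + a)) :=
      ((hz'_cont.mul continuousOn_const).mul
        (((hz_cont.sub continuousOn_const).rpow_const fun _ _ => Or.inr hα₀.le).div_const
          α)).div_const _
    refine h.congr fun t ht => ?_
    simp only [mul_assoc (z' t * N), hM, (hkernel t ht).2]
  have hbdd : BddAbove (Set.range fun t : Set.Icc t₀ (t₀ + a) =>
      z' t * N * Mα t * ((t : ℝ) - t₀) / Real.Gamma α) := by
    have h := isCompact_Icc.bddAbove_image hcont
    rwa [Set.image_eq_range] at h
  exact ciSup_mono hbdd fun t => hbd t t.2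
end

section
/- Let t₀ ∈ ℝ, a > 0, J = [t₀, t₀ + a], and let 0 < α < 1. Let z : ℝ → ℝ be continuously differentiable and strictly increasing on J with z'(t) > 0 for all t ∈ J. Let f : J × ℝ → ℝ be continuous and suppose there exists N > 0 such that |f(t,u)| ≤ N for all t ∈ J and u ∈ ℝ. Then there exists a continuous function y : J → ℝ satisfying the integral equation y(t) = (z'(t)/Γ(α)) ∫_{t₀}^{t} (z(t) − z(s))^{α−1} z'(s) f(s, y(s)) ds for all t ∈ J. -/
open Set Filter Topology MeasureTheory

/-- The unnormalised Riemann–Liouville integral of order `α` of `G` with base point `A`,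
extended by zero to the left of `A`. -/
noncomputable def rlIntegral (α A : ℝ) (G : ℝ → ℝ) (x : ℝ) : ℝ :=
  ∫ w in A..max x A, (max x A - w) ^ (α - 1) * G w

lemma rlIntegral_congr {α A x : ℝ} {G H : ℝ → ℝ} (h : ∀ w, A ≤ w → w ≤ x → G w = H w) :
    rlIntegral α A G x = rlIntegral α A H x := by
  unfold rlIntegral
  rcases le_total x A with hx | hx
  · simp [max_eq_right hx]
  · rw [max_eq_left hx]
    refine intervalIntegral.integral_congr fun w hw => ?_
    rw [uIcc_of_le hx] at hw
    simp only [h w hw.1 hw.2]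

lemma rlIntegral_of_le {α A x : ℝ} (G : ℝ → ℝ) (hx : x ≤ A) : rlIntegral α A G x = 0 := by
  simp [rlIntegral, max_eq_right hx]

lemma intervalIntegrable_sub_rpow {α : ℝ} (hα : 0 < α) (x a b : ℝ) :
    IntervalIntegrable (fun w => (x - w) ^ (α - 1)) volume a b := by
  have h := (intervalIntegral.intervalIntegrable_rpow' (a := x - a) (b := x - b)
    (r := α - 1) (by linarith)).comp_sub_left x
  simpa using h

lemma integral_sub_rpow {α : ℝ} (hα : 0 < α) (x a b : ℝ) :
    ∫ w in a..b, (x - w) ^ (α - 1) = ((x - a) ^ α - (x - b) ^ α) / α := by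
  rw [intervalIntegral.integral_comp_sub_left (fun w => w ^ (α - 1)) x,
    integral_rpow (Or.inl (by linarith))]
  simp

/-- Hölder continuity of the Riemann–Liouville integral to the right of the base point. -/
lemma abs_integral_sub_rpow_sub_le {α A N x y : ℝ} {G : ℝ → ℝ} (hα₀ : 0 < α) (hα₁ : α < 1)
    (hN : 0 ≤ N) (hG : Continuous G) (hGN : ∀ w, |G w| ≤ N) (hAx : A ≤ x) (hxy : x ≤ y) :
    |(∫ w in A..y, (y - w) ^ (α - 1) * G w) - ∫ w in A..x, (x - w) ^ (α - 1) * G w|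
      ≤ 2 * N / α * (y - x) ^ α := by
  have hint : ∀ c a b, IntervalIntegrable (fun w => (c - w) ^ (α - 1) * G w) volume a b :=
    fun c a b => (intervalIntegrable_sub_rpow hα₀ c a b).mul_continuousOn hG.continuousOn
  have hsplit : (∫ w in A..y, (y - w) ^ (α - 1) * G w) - ∫ w in A..x, (x - w) ^ (α - 1) * G w
      = (∫ w in A..x, ((y - w) ^ (α - 1) * G w - (x - w) ^ (α - 1) * G w))
        + ∫ w in x..y, (y - w) ^ (α - 1) * G w := by
    rw [intervalIntegral.integral_sub (hint _ _ _) (hint _ _ _),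
      ← intervalIntegral.integral_add_adjacent_intervals (hint y A x) (hint y x y)]
    ring
  have h1 : |∫ w in A..x, ((y - w) ^ (α - 1) * G w - (x - w) ^ (α - 1) * G w)|
      ≤ ∫ w in A..x, ((x - w) ^ (α - 1) - (y - w) ^ (α - 1)) * N := by
    rw [← Real.norm_eq_abs]
    refine intervalIntegral.norm_integral_le_of_norm_le hAx ?_
      (((intervalIntegrable_sub_rpow hα₀ x A x).sub
        (intervalIntegrable_sub_rpow hα₀ y A x)).mul_const N)
    filter_upwards [compl_mem_ae_iff.mpr (measure_singleton x)] with w hwx hw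
    have hlt : 0 < x - w := sub_pos.mpr (lt_of_le_of_ne hw.2 hwx)
    have hle : (y - w) ^ (α - 1) ≤ (x - w) ^ (α - 1) :=
      Real.rpow_le_rpow_of_nonpos hlt (by linarith) (by linarith)
    rw [← sub_mul, norm_mul, Real.norm_eq_abs, Real.norm_eq_abs, abs_sub_comm,
      abs_of_nonneg (sub_nonneg.mpr hle)]
    exact mul_le_mul_of_nonneg_left (hGN w) (sub_nonneg.mpr hle)
  have h2 : |∫ w in x..y, (y - w) ^ (α - 1) * G w| ≤ ∫ w in x..y, (y - w) ^ (α - 1) * N := by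
    rw [← Real.norm_eq_abs]
    refine intervalIntegral.norm_integral_le_of_norm_le hxy ?_
      ((intervalIntegrable_sub_rpow hα₀ y x y).mul_const N)
    refine Eventually.of_forall fun w hw => ?_
    have h0 : 0 ≤ (y - w) ^ (α - 1) := Real.rpow_nonneg (sub_nonneg.mpr hw.2) _
    rw [norm_mul, Real.norm_eq_abs, Real.norm_eq_abs, abs_of_nonneg h0]
    exact mul_le_mul_of_nonneg_left (hGN w) h0
  rw [intervalIntegral.integral_mul_const, intervalIntegral.integral_sub
    (intervalIntegrable_sub_rpow hα₀ x A x) (intervalIntegrable_sub_rpow hα₀ y A x),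
    integral_sub_rpow hα₀, integral_sub_rpow hα₀] at h1
  rw [intervalIntegral.integral_mul_const, integral_sub_rpow hα₀] at h2
  have h3 : (x - A) ^ α ≤ (y - A) ^ α :=
    Real.rpow_le_rpow (by linarith) (by linarith) hα₀.le
  rw [sub_self, Real.zero_rpow hα₀.ne'] at h1 h2
  rw [hsplit]
  refine (abs_add_le _ _).trans ((add_le_add h1 h2).trans ?_)
  have h4 : 0 ≤ N / α * ((y - A) ^ α - (x - A) ^ α) :=
    mul_nonneg (div_nonneg hN hα₀.le) (sub_nonneg.mpr h3)
  have h5 : ((((x - A) ^ α - 0) / α - ((y - A) ^ α - (y - x) ^ α) / α) * N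
      + ((y - x) ^ α - 0) / α * N)
      = 2 * N / α * (y - x) ^ α - N / α * ((y - A) ^ α - (x - A) ^ α) := by
    ring
  linarith

lemma abs_rlIntegral_sub_le {α A N : ℝ} {G : ℝ → ℝ} (hα₀ : 0 < α) (hα₁ : α < 1)
    (hN : 0 ≤ N) (hG : Continuous G) (hGN : ∀ w, |G w| ≤ N) (x y : ℝ) :
    |rlIntegral α A G x - rlIntegral α A G y| ≤ 2 * N / α * |x - y| ^ α := by
  wlog hxy : y ≤ x generalizing x y
  · rw [abs_sub_comm, abs_sub_comm x y]
    exact this y x (le_of_not_ge hxy)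
  have hmax : max y A ≤ max x A := max_le_max_right A hxy
  refine (abs_integral_sub_rpow_sub_le hα₀ hα₁ hN hG hGN (le_max_right y A) hmax).trans ?_
  have h := abs_max_sub_max_le_abs x y A
  rw [abs_of_nonneg (sub_nonneg.mpr hmax)] at h
  exact mul_le_mul_of_nonneg_left (Real.rpow_le_rpow (sub_nonneg.mpr hmax) h hα₀.le)
    (by positivity)

lemma tendsto_const_mul_rpow_zero {α : ℝ} (hα : 0 < α) (C : ℝ) :
    Tendsto (fun r : ℝ => C * r ^ α) (𝓝 0) (𝓝 0) := by
  have h := ((Real.continuousAt_rpow_const 0 α (Or.inr hα.le)).tendsto).const_mul C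
  simpa [Real.zero_rpow hα.ne'] using h

lemma continuous_rlIntegral {α A N : ℝ} {G : ℝ → ℝ} (hα₀ : 0 < α) (hα₁ : α < 1)
    (hN : 0 ≤ N) (hG : Continuous G) (hGN : ∀ w, |G w| ≤ N) :
    Continuous (rlIntegral α A G) :=
  (Metric.equicontinuous_of_continuity_modulus _ (tendsto_const_mul_rpow_zero hα₀ (2 * N / α))
    (fun _ : Unit => rlIntegral α A G)
    (fun x y _ => abs_rlIntegral_sub_le hα₀ hα₁ hN hG hGN x y)).continuous ()

/-- Tonelli's delayed equation, solved by the method of steps. -/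
lemma exists_delayed_solution {α A N δ : ℝ} {F : ℝ → ℝ → ℝ} (hα₀ : 0 < α) (hα₁ : α < 1)
    (hN : 0 ≤ N) (hδ : 0 < δ) (hF : Continuous fun p : ℝ × ℝ => F p.1 p.2)
    (hFN : ∀ w u, |F w u| ≤ N) (B : ℝ) :
    ∃ ψ : ℝ → ℝ, Continuous ψ ∧ (∀ x y, |ψ x - ψ y| ≤ 2 * N / α * |x - y| ^ α) ∧
      (∀ x ≤ A, ψ x = 0) ∧ ∀ x ≤ B, ψ x = rlIntegral α A (fun w => F w (ψ (w - δ))) x := by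
  let T : (ℝ → ℝ) → ℝ → ℝ := fun ψ => rlIntegral α A fun w => F w (ψ (w - δ))
  have hcomp : ∀ ψ : ℝ → ℝ, Continuous ψ → Continuous fun w => F w (ψ (w - δ)) :=
    fun ψ hψ => hF.comp (continuous_id.prodMk (hψ.comp (continuous_id.sub continuous_const)))
  let Ψ : ℕ → ℝ → ℝ := fun k => T^[k] fun _ => 0
  have hsucc : ∀ k, Ψ (k + 1) = T (Ψ k) := fun k => Function.iterate_succ_apply' T k _
  have hcont : ∀ k, Continuous (Ψ k) := by
    intro k
    induction k with
    | zero => exact continuous_const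
    | succ k ih =>
      rw [hsucc]
      exact continuous_rlIntegral hα₀ hα₁ hN (hcomp _ ih) fun w => hFN _ _
  have hstep : ∀ k : ℕ, ∀ x ≤ A + k * δ, Ψ (k + 1) x = Ψ k x := by
    intro k
    induction k with
    | zero =>
      intro x hx
      rw [hsucc]
      exact rlIntegral_of_le _ (by simpa using hx)
    | succ k ih =>
      intro x hx
      rw [hsucc (k + 1)]
      conv_rhs => rw [hsucc k]
      refine rlIntegral_congr fun w _ hwx => ?_
      rw [ih (w - δ) (by push_cast at hx; linarith)]
  obtain ⟨k, hk⟩ := exists_nat_ge ((B - A) / δ)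
  rw [div_le_iff₀ hδ] at hk
  refine ⟨Ψ (k + 1), hcont _, fun x y => ?_, fun x hx => ?_, fun x hx => ?_⟩
  · rw [hsucc]
    exact abs_rlIntegral_sub_le hα₀ hα₁ hN (hcomp _ (hcont k)) (fun w => hFN _ _) x y
  · rw [hsucc]
    exact rlIntegral_of_le _ hx
  · conv_lhs => rw [hsucc]
    refine rlIntegral_congr fun w _ hwx => ?_
    rw [hstep k (w - δ) (by linarith)]

/-- A weakly singular Volterra equation with continuous bounded nonlinearity has a continuous
solution. -/
theorem exists_continuous_volterra_solution {α A B N : ℝ} {F : ℝ → ℝ → ℝ} (hα₀ : 0 < α)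
    (hα₁ : α < 1) (hN : 0 ≤ N) (hAB : A ≤ B) (hF : Continuous fun p : ℝ × ℝ => F p.1 p.2)
    (hFN : ∀ w u, |F w u| ≤ N) :
    ∃ ψ : ℝ → ℝ, Continuous ψ ∧
      ∀ x ∈ Icc A B, ψ x = ∫ w in A..x, (x - w) ^ (α - 1) * F w (ψ w) := by
  set C : ℝ := 2 * N / α with hC
  have hC0 : 0 ≤ C := by positivity
  let δ : ℕ → ℝ := fun n => 1 / ((n : ℝ) + 1)
  have hδ : ∀ n, 0 < δ n := fun n => Nat.one_div_pos_of_nat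
  choose ψ hψc hψH hψ0 hψ using fun n =>
    exists_delayed_solution (A := A) hα₀ hα₁ hN (hδ n) hF hFN B
  let S : Set (BoundedContinuousFunction (Icc A B) ℝ) :=
    {g | (∀ x, g x ∈ Icc (-(C * (B - A) ^ α)) (C * (B - A) ^ α)) ∧
      ∀ x y, dist (g x) (g y) ≤ C * dist x y ^ α}
  have hS : IsCompact (closure S) :=
    BoundedContinuousFunction.arzela_ascoli _ isCompact_Icc S (fun g x hg => hg.1 x)
      (Metric.equicontinuous_of_continuity_modulus _ (tendsto_const_mul_rpow_zero hα₀ C) _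
        fun x y g => g.2.2 x y)
  let G : ℕ → BoundedContinuousFunction (Icc A B) ℝ := fun n =>
    BoundedContinuousFunction.mkOfCompact ⟨fun x => ψ n x, (hψc n).comp continuous_subtype_val⟩
  have hGS : ∀ n, G n ∈ S := by
    refine fun n => ⟨fun x => abs_le.mp ?_, fun x y => hψH n x y⟩
    have h := hψH n x A
    rw [hψ0 n A le_rfl, sub_zero] at h
    refine h.trans (mul_le_mul_of_nonneg_left (Real.rpow_le_rpow (abs_nonneg _) ?_ hα₀.le) hC0)
    rw [abs_of_nonneg (sub_nonneg.mpr x.2.1)]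
    linarith [x.2.2]
  obtain ⟨g, -, φ, hφ, hlim⟩ := hS.tendsto_subseq fun n => subset_closure (hGS n)
  have hpt : ∀ x (hx : x ∈ Icc A B), Tendsto (fun n => ψ (φ n) x) atTop (𝓝 (g ⟨x, hx⟩)) :=
    fun x hx =>
      (BoundedContinuousFunction.tendsto_iff_tendstoUniformly.mp hlim).tendsto_at ⟨x, hx⟩
  have hδ0 : Tendsto (fun n => δ (φ n)) atTop (𝓝 0) :=
    tendsto_one_div_add_atTop_nhds_zero_nat.comp hφ.tendsto_atTop
  have hpt' : ∀ x (hx : x ∈ Icc A B),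
      Tendsto (fun n => ψ (φ n) (x - δ (φ n))) atTop (𝓝 (g ⟨x, hx⟩)) := by
    intro x hx
    have h0 : Tendsto (fun n => ψ (φ n) (x - δ (φ n)) - ψ (φ n) x) atTop (𝓝 0) := by
      refine squeeze_zero_norm (fun n => ?_) ((tendsto_const_mul_rpow_zero hα₀ C).comp hδ0)
      have h := hψH (φ n) (x - δ (φ n)) x
      rwa [sub_sub_cancel_left, abs_neg, abs_of_pos (hδ _)] at h
    simpa using h0.add (hpt x hx)
  refine ⟨IccExtend hAB g, g.continuous.Icc_extend', fun x hx => ?_⟩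
  rw [IccExtend_of_mem hAB _ hx]
  refine tendsto_nhds_unique (hpt x hx) ?_
  have hev : ∀ n, ψ (φ n) x
      = ∫ w in A..x, (x - w) ^ (α - 1) * F w (ψ (φ n) (w - δ (φ n))) := by
    intro n
    rw [hψ (φ n) x hx.2, rlIntegral, max_eq_left hx.1]
  simp_rw [hev]
  refine intervalIntegral.tendsto_integral_filter_of_dominated_convergence
    (fun w => (x - w) ^ (α - 1) * N) (Eventually.of_forall fun n => ?_)
    (Eventually.of_forall fun n => Eventually.of_forall fun w hw => ?_)
    ((intervalIntegrable_sub_rpow hα₀ x A x).mul_const N) (Eventually.of_forall fun w hw => ?_)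
  · have hc : Continuous fun w => F w (ψ (φ n) (w - δ (φ n))) :=
      hF.comp (continuous_id.prodMk ((hψc _).comp (continuous_id.sub continuous_const)))
    exact ((intervalIntegrable_sub_rpow hα₀ x A x).mul_continuousOn
      hc.continuousOn).aestronglyMeasurable_restrict_uIoc
  · rw [uIoc_of_le hx.1] at hw
    have h0 : 0 ≤ (x - w) ^ (α - 1) := Real.rpow_nonneg (sub_nonneg.mpr hw.2) _
    rw [norm_mul, Real.norm_eq_abs, Real.norm_eq_abs, abs_of_nonneg h0]
    exact mul_le_mul_of_nonneg_left (hFN _ _) h0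
  · rw [uIoc_of_le hx.1] at hw
    have hw' : w ∈ Icc A B := ⟨hw.1.le, hw.2.trans hx.2⟩
    rw [IccExtend_of_mem hAB _ hw']
    exact ((hF.tendsto (w, g ⟨w, hw'⟩)).comp
      (tendsto_const_nhds.prodMk_nhds (hpt' w hw'))).const_mul _

/-- A continuous strictly monotone function on a compact interval has a continuous left inverse
taking values in that interval. -/
lemma exists_continuous_leftInvOn {z : ℝ → ℝ} {t₀ t₁ : ℝ} (h : t₀ ≤ t₁)
    (hz : ContinuousOn z (Icc t₀ t₁)) (hmono : StrictMonoOn z (Icc t₀ t₁)) :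
    ∃ q : ℝ → ℝ, Continuous q ∧ (∀ w, q w ∈ Icc t₀ t₁) ∧ ∀ t ∈ Icc t₀ t₁, q (z t) = t := by
  have himg : z '' Icc t₀ t₁ = Icc (z t₀) (z t₁) := by
    refine Subset.antisymm ?_ (intermediate_value_Icc h hz)
    exact (hmono.monotoneOn.mapsTo_Icc).image_subset
  have hle : z t₀ ≤ z t₁ := hmono.monotoneOn (left_mem_Icc.mpr h) (right_mem_Icc.mpr h) h
  let e : Icc t₀ t₁ ≃o Icc (z t₀) (z t₁) :=
    (hmono.orderIso z _).trans (OrderIso.setCongr _ _ himg)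
  refine ⟨fun w => e.symm (projIcc _ _ hle w),
    continuous_subtype_val.comp (e.symm.continuous.comp continuous_projIcc),
    fun w => (e.symm _).2, fun t ht => ?_⟩
  have h1 : projIcc _ _ hle (z t) = e ⟨t, ht⟩ := projIcc_of_mem hle (e ⟨t, ht⟩).2
  simp [h1]

/-- Change of variables along a strictly increasing differentiable function, with no regularity
assumption on the integrand. -/
lemma integral_eq_integral_deriv_mul_of_strictMonoOn {z z' : ℝ → ℝ} {t₀ t : ℝ} (h : t₀ ≤ t)
    (hderiv : ∀ s ∈ Icc t₀ t, HasDerivAt z (z' s) s) (hmono : StrictMonoOn z (Icc t₀ t))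
    (hpos : ∀ s ∈ Icc t₀ t, 0 ≤ z' s) (g : ℝ → ℝ) :
    ∫ w in z t₀..z t, g w = ∫ s in t₀..t, z' s * g (z s) := by
  have hcont : ContinuousOn z (Icc t₀ t) :=
    fun s hs => (hderiv s hs).continuousAt.continuousWithinAt
  have himg : z '' Icc t₀ t = Icc (z t₀) (z t) :=
    Subset.antisymm (hmono.monotoneOn.mapsTo_Icc).image_subset (intermediate_value_Icc h hcont)
  have hle : z t₀ ≤ z t := hmono.monotoneOn (left_mem_Icc.mpr h) (right_mem_Icc.mpr h) h
  rw [intervalIntegral.integral_of_le hle, intervalIntegral.integral_of_le h,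
    ← integral_Icc_eq_integral_Ioc, ← integral_Icc_eq_integral_Ioc, ← himg,
    integral_image_eq_integral_abs_deriv_smul measurableSet_Icc
      (fun s hs => (hderiv s hs).hasDerivWithinAt) hmono.injOn]
  refine setIntegral_congr_fun measurableSet_Icc fun s hs => ?_
  simp only [abs_of_nonneg (hpos s hs), smul_eq_mul]

/-- the paper's Theorem 3.6, case `𝕋 = ℝ`: existence via Schauder's
fixed point theorem. If `f` is continuous with `|f(t,u)| ≤ N` on `J × ℝ`, then
there exists a continuous function `y` on `J` satisfying the integral equation
`y t = (z' t / Γ α) ∫_{t₀}^{t} (z t − z s)^(α−1) z' s · f s (y s) ds`. -/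
theorem existence_schauder
    (t₀ a α : ℝ) (ha : 0 < a) (hα₀ : 0 < α) (hα₁ : α < 1)
    (z z' : ℝ → ℝ)
    (hz_deriv : ∀ t ∈ Set.Icc t₀ (t₀ + a), HasDerivAt z (z' t) t)
    (hz'_cont : ContinuousOn z' (Set.Icc t₀ (t₀ + a)))
    (hz_mono : StrictMonoOn z (Set.Icc t₀ (t₀ + a)))
    (hz'_pos : ∀ t ∈ Set.Icc t₀ (t₀ + a), 0 < z' t)
    (f : ℝ → ℝ → ℝ)
    (hf : ContinuousOn (fun p : ℝ × ℝ => f p.1 p.2) (Set.Icc t₀ (t₀ + a) ×ˢ Set.univ))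
    (N : ℝ) (hN : 0 < N)
    (hbound : ∀ t ∈ Set.Icc t₀ (t₀ + a), ∀ u : ℝ, |f t u| ≤ N) :
    ∃ y : ℝ → ℝ, ContinuousOn y (Set.Icc t₀ (t₀ + a)) ∧
      ∀ t ∈ Set.Icc t₀ (t₀ + a),
        y t = z' t / Real.Gamma α *
          ∫ s in t₀..t, (z t - z s) ^ (α - 1) * z' s * f s (y s) := by
  have hle : t₀ ≤ t₀ + a := by linarith
  have hz_cont : ContinuousOn z (Icc t₀ (t₀ + a)) :=
    fun s hs => (hz_deriv s hs).continuousAt.continuousWithinAt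
  obtain ⟨q, hqc, hqmem, hq⟩ := exists_continuous_leftInvOn hle hz_cont hz_mono
  have hF : Continuous fun p : ℝ × ℝ => f (q p.1) (z' (q p.1) / Real.Gamma α * p.2) := by
    have hc : Continuous fun w => z' (q w) := hz'_cont.comp_continuous hqc hqmem
    exact hf.comp_continuous ((hqc.comp continuous_fst).prodMk
      (((hc.comp continuous_fst).div_const _).mul continuous_snd))
      fun p => ⟨hqmem p.1, mem_univ _⟩
  obtain ⟨ψ, hψc, hψ⟩ := exists_continuous_volterra_solution
    (F := fun w u => f (q w) (z' (q w) / Real.Gamma α * u)) hα₀ hα₁ hN.le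
    (hz_mono.monotoneOn (left_mem_Icc.mpr hle) (right_mem_Icc.mpr hle) hle) hF
    fun w u => hbound _ (hqmem w) _
  refine ⟨fun t => z' t / Real.Gamma α * ψ (z t),
    (hz'_cont.div_const _).mul (hψc.comp_continuousOn hz_cont), fun t ht => ?_⟩
  have hsub : Icc t₀ t ⊆ Icc t₀ (t₀ + a) := Icc_subset_Icc_right ht.2
  simp only
  rw [hψ (z t) (hz_mono.monotoneOn.mapsTo_Icc ht),
    integral_eq_integral_deriv_mul_of_strictMonoOn ht.1 (fun s hs => hz_deriv s (hsub hs))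
      (hz_mono.mono hsub) fun s hs => (hz'_pos s (hsub hs)).le]
  congr 1
  refine intervalIntegral.integral_congr fun s hs => ?_
  rw [uIcc_of_le ht.1] at hs
  simp only [hq s (hsub hs)]
  ring
end
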